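/- arXiv:1805.11389 — 2 statements merged into one kernel-verified Lean document; each statement's English description precedes it below -/
import Mathlib

section
/- Assume (F0)-(F4), and for each ε > 0 let u_ε : [0,T] → X be a C² solution of ε² A ü_ε(t) + ε B u̇_ε(t) + ∇ₓF(t, u_ε(t)) = 0 on [0,T], with ‖u_ε(0)‖ ≤ R and ε‖u̇_ε(0)‖ ≤ R for all ε > 0. Then there exists a constant C > 0, independent of ε, such that for all ε > 0: (v) (1/(2ε)) ∫_0^T ‖∇ₓF(r, u_ε(r)) + ε² A ü_ε(r)‖² dr ≤ C; (vi) ε |∫_0^T ⟨ü_ε(r), ∇ₓF(r, u_ε(r))⟩ dr| ≤ C; (vii) (1/(2ε)) ∫_0^T ‖∇ₓF(r, u_ε(r))‖² dr ≤ C; (viii) ε³ ∫_0^T ‖ü_ε(r)‖² dr ≤ C. -/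
open Set Filter Topology MeasureTheory
open scoped RealInnerProductSpace

lemma aux_coercive {X : Type*} [NormedAddCommGroup X] [InnerProductSpace ℝ X]
    [FiniteDimensional ℝ X] (A : X →L[ℝ] X) (hApos : ∀ x : X, x ≠ 0 → 0 < ⟪x, A x⟫) :
    ∃ α > (0:ℝ), ∀ x : X, α * ‖x‖ ^ 2 ≤ ⟪x, A x⟫ := by
  have : ProperSpace X := FiniteDimensional.proper ℝ X
  by_cases hne : (Metric.sphere (0:X) 1).Nonempty
  · obtain ⟨z, hz, hmin⟩ := (isCompact_sphere (0:X) 1).exists_isMinOn hne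
      (f := fun x => ⟪x, A x⟫) (by fun_prop)
    have hz1 : ‖z‖ = 1 := by simpa using hz
    refine ⟨⟪z, A z⟫, hApos z (by intro h; simp [h] at hz1), fun x => ?_⟩
    by_cases hx : x = 0
    · simp [hx]
    have hx' : 0 < ‖x‖ := norm_pos_iff.2 hx
    have h1 : ⟪z, A z⟫ ≤ ⟪‖x‖⁻¹ • x, A (‖x‖⁻¹ • x)⟫ := by
      apply hmin
      simp [norm_smul, hx'.ne']
    simp only [map_smul, inner_smul_left, inner_smul_right] at h1
    simp only [conj_trivial] at h1
    calc _ ≤ (‖x‖⁻¹ * (‖x‖⁻¹ * ⟪x, A x⟫)) * ‖x‖^2 := by gcongr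
      _ = _ := by field_simp
  · refine ⟨1, one_pos, fun x => ?_⟩
    by_cases hx : x = 0
    · simp [hx]
    exact absurd ⟨‖x‖⁻¹ • x, by simp [norm_smul, hx]⟩ hne

lemma aux_chain_F {X : Type*} [NormedAddCommGroup X] [InnerProductSpace ℝ X] [CompleteSpace X]
    {T : ℝ} (hT : 0 < T) {F dtF : ℝ → X → ℝ} {gradF : ℝ → X → X}
    (hF0 : ContDiffOn ℝ 1 (fun p : ℝ × X => F p.1 p.2) (Set.Icc 0 T ×ˢ Set.univ))
    (hgradF : ∀ t ∈ Set.Icc 0 T, ∀ x : X, HasGradientAt (F t) (gradF t x) x)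
    (hdtF : ∀ x : X, ∀ t ∈ Set.Icc 0 T,
      HasDerivWithinAt (fun τ => F τ x) (dtF t x) (Set.Icc 0 T) t)
    {u : ℝ → X} {v : X} {t : ℝ} (ht : t ∈ Icc 0 T) (hu : HasDerivWithinAt u v (Icc 0 T) t) :
    HasDerivWithinAt (fun s => F s (u s)) (dtF t (u t) + ⟪gradF t (u t), v⟫) (Icc 0 T) t := by
  obtain ⟨L, hL⟩ : ∃ L, HasFDerivWithinAt (fun p : ℝ × X => F p.1 p.2) L
      (Set.Icc 0 T ×ˢ Set.univ) (t, u t) :=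
    (hF0.differentiableOn one_ne_zero) (t, u t) ⟨ht, mem_univ _⟩
  have key : ∀ {w : ℝ → X} {z : X}, w t = u t → HasDerivWithinAt w z (Icc 0 T) t →
      HasDerivWithinAt (fun s => F s (w s)) (L (1, z)) (Icc 0 T) t := by
    intro w z hwt hw
    have h1 : HasDerivWithinAt (fun s => (s, w s)) ((1:ℝ), z) (Icc 0 T) t :=
      (hasDerivWithinAt_id t _).prodMk hw
    rw [← hwt] at hL
    have hm : MapsTo (fun s => (s, w s)) (Icc 0 T) (Set.Icc 0 T ×ˢ (Set.univ : Set X)) :=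
      fun s hs => ⟨hs, mem_univ _⟩
    exact HasFDerivWithinAt.comp_hasDerivWithinAt t hL h1 hm
  have hun : UniqueDiffWithinAt ℝ (Icc 0 T) t := uniqueDiffOn_Icc hT t ht
  have e1 : L (1, 0) = dtF t (u t) :=
    hun.eq_deriv _ (key (w := fun _ => u t) rfl (hasDerivWithinAt_const _ _ _)) (hdtF _ t ht)
  have e2 : L (0, v) = ⟪gradF t (u t), v⟫ := by
    have h1 : HasFDerivAt (fun x : X => (t, x)) (ContinuousLinearMap.inr ℝ ℝ X) (u t) :=
      hasFDerivAt_prodMk_right t (u t)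
    have h2 : HasFDerivAt (fun x => F t x) (L.comp (ContinuousLinearMap.inr ℝ ℝ X)) (u t) := by
      rw [← hasFDerivWithinAt_univ] at h1 ⊢
      exact HasFDerivWithinAt.comp (u t) hL h1 (fun s hs => ⟨ht, mem_univ _⟩)
    have h3 := h2.unique (hgradF t ht (u t)).hasFDerivAt
    have := congrArg (fun l => l v) h3
    simpa using this
  have h := key rfl hu
  have e3 : L (1, v) = dtF t (u t) + ⟪gradF t (u t), v⟫ := by
    rw [← e1, ← e2, ← map_add]; simp
  rwa [e3] at h

lemma aux_chain_grad {X : Type*} [NormedAddCommGroup X] [NormedSpace ℝ X]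
    {S : Set ℝ} {g dtg : ℝ → X → X} {H : ℝ → X → X →L[ℝ] X}
    (hdt : ∀ x : X, ∀ t ∈ S, HasDerivWithinAt (fun τ => g τ x) (dtg t x) S t)
    (hH : ∀ t ∈ S, ∀ x : X, HasFDerivAt (g t) (H t x) x)
    (hHc : ContinuousOn (fun p : ℝ × X => H p.1 p.2) (S ×ˢ Set.univ))
    {u : ℝ → X} {v : X} {t : ℝ} (ht : t ∈ S) (hu : HasDerivWithinAt u v S t) :
    HasDerivWithinAt (fun s => g s (u s)) (dtg t (u t) + H t (u t) v) S t := by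
  have hlin : HasDerivWithinAt (fun s => g s (u t) + H t (u t) (u s))
      (dtg t (u t) + H t (u t) v) S t :=
    (hdt (u t) t ht).add ((H t (u t)).hasFDerivAt.comp_hasDerivWithinAt t hu)
  have hrem : HasDerivWithinAt (fun s => g s (u s) - g s (u t) - H t (u t) (u s - u t))
      0 S t := by
    have ho : (fun s => g s (u s) - g s (u t) - H t (u t) (u s - u t)) =o[𝓝[S] t]
        (fun s => u s - u t) := by
      rw [Asymptotics.isLittleO_iff]
      intro c hc
      have h1 := (Metric.continuousOn_iff.1 hHc) (t, u t) ⟨ht, mem_univ _⟩ c hc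
      obtain ⟨δ, hδ, h1⟩ := h1
      have h2 : ∀ᶠ s in 𝓝[S] t, dist (u s) (u t) < δ :=
        hu.continuousWithinAt.eventually (Metric.ball_mem_nhds _ hδ)
      have h3 : ∀ᶠ s in 𝓝[S] t, dist s t < δ :=
        mem_nhdsWithin_of_mem_nhds (Metric.ball_mem_nhds _ hδ)
      filter_upwards [h2, h3, self_mem_nhdsWithin] with s hs2 hs3 hs
      refine (convex_ball (u t) δ).norm_image_sub_le_of_norm_hasFDerivWithin_le' (𝕜 := ℝ)
        (f := g s) (f' := H s) (fun x _ => (hH s hs x).hasFDerivWithinAt) (fun x hx => ?_)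
        (Metric.mem_ball_self hδ) hs2
      rw [← dist_eq_norm]
      exact (h1 (s, x) ⟨hs, mem_univ _⟩ (by rw [Prod.dist_eq]; exact max_lt hs3 hx)).le
    have hO : (fun s => u s - u t) =O[𝓝[S] t] (fun s => s - t) := hu.hasFDerivWithinAt.isBigO_sub
    rw [hasDerivWithinAt_iff_isLittleO]
    simpa using ho.trans_isBigO hO
  have := (hlin.add hrem).sub_const (H t (u t) (u t))
  rw [add_zero] at this
  refine this.congr_of_eventuallyEq (Eventually.of_forall fun s => ?_) ?_
  · simp [map_sub]
    abel
  · simp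

lemma aux_decay {T c : ℝ} {f f' : ℝ → ℝ}
    (hf : ∀ t ∈ Icc 0 T, HasDerivWithinAt f (f' t) (Icc 0 T) t)
    (hle : ∀ t ∈ Icc 0 T, f' t ≤ c * f t) {s t : ℝ} (hs : s ∈ Icc 0 T) (ht : t ∈ Icc 0 T)
    (hst : s ≤ t) : f t ≤ f s * Real.exp (c * (t - s)) := by
  have hd : ∀ r ∈ Icc 0 T, HasDerivWithinAt (fun r => f r * Real.exp (-c * r))
      (f' r * Real.exp (-c * r) + f r * (Real.exp (-c * r) * (-c * 1))) (Icc 0 T) r :=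
    fun r hr => (hf r hr).mul ((((hasDerivAt_id r).const_mul (-c)).exp).hasDerivWithinAt)
  have ha : AntitoneOn (fun r => f r * Real.exp (-c * r)) (Icc 0 T) := by
    refine antitoneOn_of_hasDerivWithinAt_nonpos (convex_Icc 0 T)
      (fun r hr => (hd r hr).continuousWithinAt)
      (fun r hr => (hd r (interior_subset hr)).mono interior_subset) (fun r hr => ?_)
    have := hle r (interior_subset hr)
    have h2 := Real.exp_pos (-c * r)
    nlinarith
  have h := ha hs ht hst
  simp only at h
  have e : f s * Real.exp (c * (t - s)) = (f s * Real.exp (-c * s)) * Real.exp (c * t) := by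
    rw [mul_assoc, ← Real.exp_add]; ring_nf
  have e2 : f t = (f t * Real.exp (-c * t)) * Real.exp (c * t) := by
    rw [mul_assoc, ← Real.exp_add]; simp
  rw [e, e2]
  gcongr

lemma aux_energy {X : Type*} [NormedAddCommGroup X] [InnerProductSpace ℝ X]
    {A B : X →L[ℝ] X}
    (hAsymm : ∀ x y : X, ⟪A x, y⟫ = ⟪x, A y⟫)
    {α β : ℝ} (hα : 0 < α) (hβ : 0 < β) (hA : ∀ x : X, α * ‖x‖ ^ 2 ≤ ⟪x, A x⟫)
    (hB : ∀ x : X, β * ‖x‖ ^ 2 ≤ ⟪x, B x⟫)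
    {T : ℝ} (hT : 0 < T)
    {F dtF : ℝ → X → ℝ} {gradF : ℝ → X → X}
    {C₁ C₂ : ℝ} (hC₁ : 0 < C₁)
    (hF2 : ∀ t ∈ Set.Icc 0 T, ∀ x : X, |dtF t x| ≤ C₁ * F t x + C₂)
    {u u' u'' : ℝ → X} {ε : ℝ} (hε : 0 < ε)
    (hFu : ∀ t ∈ Icc 0 T, HasDerivWithinAt (fun s => F s (u s))
      (dtF t (u t) + ⟪gradF t (u t), u' t⟫) (Icc 0 T) t)
    (hu'' : ∀ t ∈ Set.Icc 0 T, HasDerivWithinAt u' (u'' t) (Set.Icc 0 T) t)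
    (hode : ∀ t ∈ Set.Icc 0 T, ε ^ 2 • A (u'' t) + ε • B (u' t) + gradF t (u t) = 0)
    {R F0 : ℝ} (hF00 : F 0 (u 0) ≤ F0) (hinit : ε * ‖u' 0‖ ≤ R) {K : ℝ}
    (hK : K = (‖A‖ * R ^ 2 / 2 + F0 + C₂ / C₁) * Real.exp (C₁ * T)) :
    (∀ t ∈ Icc 0 T, F t (u t) + C₂ / C₁ ≤ K) ∧
    (∀ t ∈ Icc 0 T, α / 2 * (ε * ‖u' t‖) ^ 2 ≤ K) ∧
    β * (ε * ∫ t in (0:ℝ)..T, ‖u' t‖ ^ 2) ≤ K + T * (C₁ * K) := by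
  have h0 : (0:ℝ) ∈ Icc 0 T := ⟨le_rfl, hT.le⟩
  have hTT : T ∈ Icc 0 T := ⟨hT.le, le_rfl⟩
  have hcF : ∀ t ∈ Icc 0 T, ∀ x, 0 ≤ F t x + C₂ / C₁ := by
    intro t ht x
    have h1 := (abs_nonneg _).trans (hF2 t ht x)
    have h2 : C₁ * F t x + C₂ = C₁ * (F t x + C₂ / C₁) := by field_simp
    rw [h2] at h1
    exact nonneg_of_mul_nonneg_right h1 hC₁
  have hA0 : ∀ x, 0 ≤ ⟪x, A x⟫ := fun x => le_trans (by positivity) (hA x)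
  set E : ℝ → ℝ := fun t => ε ^ 2 / 2 * ⟪u' t, A (u' t)⟫ + F t (u t) + C₂ / C₁ with hE
  have hEd : ∀ t ∈ Icc 0 T,
      HasDerivWithinAt E (dtF t (u t) - ε * ⟪u' t, B (u' t)⟫) (Icc 0 T) t := by
    intro t ht
    have h1 := (hu'' t ht).inner ℝ (A.hasFDerivAt.comp_hasDerivWithinAt t (hu'' t ht))
    have h2 := ((h1.const_mul (ε ^ 2 / 2)).add (hFu t ht)).add_const (C₂ / C₁)
    refine h2.congr_deriv ?_
    have e1 : gradF t (u t) = -(ε ^ 2 • A (u'' t) + ε • B (u' t)) :=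
      (neg_eq_of_add_eq_zero_right (hode t ht)).symm
    rw [e1]
    simp only [inner_neg_left, inner_add_left, real_inner_smul_left]
    have e2 : ⟪u'' t, A (u' t)⟫ = ⟪A (u'' t), u' t⟫ := (hAsymm _ _).symm
    have e3 : ⟪u' t, A (u'' t)⟫ = ⟪A (u'' t), u' t⟫ := real_inner_comm _ _
    have e4 : ⟪u' t, B (u' t)⟫ = ⟪B (u' t), u' t⟫ := real_inner_comm _ _
    simp only [Function.comp_apply]
    rw [e2, e3, e4]
    ring
  have hE0 : E 0 ≤ ‖A‖ * R ^ 2 / 2 + F0 + C₂ / C₁ := by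
    have h1 : ⟪u' 0, A (u' 0)⟫ ≤ ‖u' 0‖ * (‖A‖ * ‖u' 0‖) :=
      (real_inner_le_norm _ _).trans (by gcongr; exact A.le_opNorm _)
    have h2 : ε ^ 2 / 2 * ⟪u' 0, A (u' 0)⟫ ≤ ‖A‖ * R ^ 2 / 2 := by
      calc ε ^ 2 / 2 * ⟪u' 0, A (u' 0)⟫ ≤ ε ^ 2 / 2 * (‖u' 0‖ * (‖A‖ * ‖u' 0‖)) := by gcongr
        _ = ‖A‖ * (ε * ‖u' 0‖) ^ 2 / 2 := by ring
        _ ≤ _ := by gcongr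
    simp only [hE]
    linarith
  have hEF : ∀ t, F t (u t) + C₂ / C₁ ≤ E t := by
    intro t
    have : 0 ≤ ε ^ 2 / 2 * ⟪u' t, A (u' t)⟫ := mul_nonneg (by positivity) (hA0 _)
    simp only [hE]
    linarith
  have hEp : ∀ t ∈ Icc 0 T, 0 ≤ E t := fun t ht => (hcF t ht _).trans (hEF t)
  have hdt : ∀ t ∈ Icc 0 T, dtF t (u t) ≤ C₁ * E t := by
    intro t ht
    have h1 := (le_abs_self _).trans (hF2 t ht (u t))
    have h2 : C₁ * F t (u t) + C₂ = C₁ * (F t (u t) + C₂ / C₁) := by field_simp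
    rw [h2] at h1
    exact h1.trans (by have := hEF t; gcongr)
  have hEK : ∀ t ∈ Icc 0 T, E t ≤ K := by
    intro t ht
    refine (aux_decay (c := C₁) hEd (fun r hr => ?_) h0 ht ht.1).trans ?_
    · have hBn : 0 ≤ ε * ⟪u' r, B (u' r)⟫ :=
        mul_nonneg hε.le (le_trans (by positivity) (hB _))
      linarith [hdt r hr]
    · rw [hK]
      have h1 : 0 ≤ ‖A‖ * R ^ 2 / 2 + F0 + C₂ / C₁ := (hEp 0 h0).trans hE0
      have h2 : t - 0 ≤ T := by simpa using ht.2
      gcongr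
  refine ⟨fun t ht => (hEF t).trans (hEK t ht), fun t ht => ?_, ?_⟩
  · refine le_trans ?_ (hEK t ht)
    have h1 := hcF t ht (u t)
    have h2 : α / 2 * (ε * ‖u' t‖) ^ 2 ≤ ε ^ 2 / 2 * ⟪u' t, A (u' t)⟫ := by
      calc α / 2 * (ε * ‖u' t‖) ^ 2 = ε ^ 2 / 2 * (α * ‖u' t‖ ^ 2) := by ring
        _ ≤ _ := by have := hA (u' t); gcongr
    simp only [hE]
    linarith
  · have hu'c : ContinuousOn u' (Icc 0 T) := fun t ht => (hu'' t ht).continuousWithinAt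
    have i2 : IntegrableOn (fun t => ‖u' t‖ ^ 2) (Icc 0 T) :=
      ContinuousOn.integrableOn_Icc (by fun_prop)
    have i3 : IntegrableOn (fun t => C₁ * K - β * ε * ‖u' t‖ ^ 2) (Icc 0 T) :=
      ContinuousOn.integrableOn_Icc (by fun_prop)
    have hle := intervalIntegral.sub_le_integral_of_hasDeriv_right_of_le hT.le
      (fun t ht => (hEd t ht).continuousWithinAt)
      (fun t ht => ((hEd t (Ioo_subset_Icc_self ht)).hasDerivAt
        (Icc_mem_nhds ht.1 ht.2)).hasDerivWithinAt) i3 (by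
        intro t ht
        replace ht := Ioo_subset_Icc_self ht
        have h1 : C₁ * E t ≤ C₁ * K := by have := hEK t ht; gcongr
        have h2 : ε * (β * ‖u' t‖ ^ 2) ≤ ε * ⟪u' t, B (u' t)⟫ := by
          have := hB (u' t); gcongr
        linarith [hdt t ht])
    rw [intervalIntegral.integral_sub] at hle
    · simp only [intervalIntegral.integral_const_mul, intervalIntegral.integral_const,
        smul_eq_mul, sub_zero] at hle
      linarith [hEp T hTT, hEK 0 h0]
    · simp
    · rw [intervalIntegrable_iff_integrableOn_Icc_of_le hT.le]
      exact i2.const_mul _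

lemma aux_lower {X : Type*} [NormedAddCommGroup X] [InnerProductSpace ℝ X]
    {T : ℝ} (hT : 0 < T) {u' u'' g dtg : ℝ → X} {H : ℝ → X →L[ℝ] X} {a : ℝ → ℝ}
    (ha : IntegrableOn a (Icc 0 T)) (hdtg : ∀ t ∈ Icc 0 T, ‖dtg t‖ ≤ a t)
    {G Hb K2 K3 ε : ℝ} (hε : 0 < ε) (hG : ∀ t ∈ Icc 0 T, ‖g t‖ ≤ G)
    (hH : ∀ t ∈ Icc 0 T, ‖H t‖ ≤ Hb) (hHb : 0 ≤ Hb)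
    (hg : ∀ t ∈ Icc 0 T, HasDerivWithinAt g (dtg t + H t (u' t)) (Icc 0 T) t)
    (hu'' : ∀ t ∈ Set.Icc 0 T, HasDerivWithinAt u' (u'' t) (Set.Icc 0 T) t)
    (hu''c : ContinuousOn u'' (Icc 0 T))
    (hK2 : ∀ t ∈ Icc 0 T, ε * ‖u' t‖ ≤ K2) (hK3 : ε * ∫ t in (0:ℝ)..T, ‖u' t‖ ^ 2 ≤ K3)
    (L : X →L[ℝ] X) :
    -(‖L‖ * (2 * (K2 * G) + K2 * (∫ t in (0:ℝ)..T, a t) + Hb * K3)) ≤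
      ε * ∫ t in (0:ℝ)..T, ⟪L (u'' t), g t⟫ := by
  have h0 : (0:ℝ) ∈ Icc 0 T := ⟨le_rfl, hT.le⟩
  have hTT : T ∈ Icc 0 T := ⟨hT.le, le_rfl⟩
  have hu'c : ContinuousOn u' (Icc 0 T) := fun t ht => (hu'' t ht).continuousWithinAt
  have hgc : ContinuousOn g (Icc 0 T) := fun t ht => (hg t ht).continuousWithinAt
  have hd : ∀ t ∈ Icc 0 T, HasDerivWithinAt (fun t => ε * ⟪L (u' t), g t⟫)
      (ε * (⟪L (u' t), dtg t + H t (u' t)⟫ + ⟪L (u'' t), g t⟫)) (Icc 0 T) t := fun t ht =>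
    ((L.hasFDerivAt.comp_hasDerivWithinAt t (hu'' t ht)).inner ℝ (hg t ht)).const_mul ε
  have i1 : IntegrableOn (fun t => ⟪L (u'' t), g t⟫) (Icc 0 T) :=
    ContinuousOn.integrableOn_Icc (by fun_prop)
  have i2 : IntegrableOn (fun t => ‖u' t‖ ^ 2) (Icc 0 T) :=
    ContinuousOn.integrableOn_Icc (by fun_prop)
  have i3 : IntegrableOn (fun t => ε * ⟪L (u'' t), g t⟫ +
      (‖L‖ * K2 * a t + ‖L‖ * Hb * ε * ‖u' t‖ ^ 2)) (Icc 0 T) :=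
    (i1.const_mul ε).add ((ha.const_mul (‖L‖ * K2)).add (i2.const_mul (‖L‖ * Hb * ε)))
  have hle := intervalIntegral.sub_le_integral_of_hasDeriv_right_of_le hT.le
    (fun t ht => (hd t ht).continuousWithinAt)
    (fun t ht => ((hd t (Ioo_subset_Icc_self ht)).hasDerivAt
      (Icc_mem_nhds ht.1 ht.2)).hasDerivWithinAt)
    (φ := fun t => ε * ⟪L (u'' t), g t⟫ + (‖L‖ * K2 * a t + ‖L‖ * Hb * ε * ‖u' t‖ ^ 2))
    i3 (by
      intro t ht
      replace ht := Ioo_subset_Icc_self ht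
      rw [inner_add_right]
      have b1 : ε * ⟪L (u' t), dtg t⟫ ≤ ‖L‖ * K2 * a t := by
        calc ε * ⟪L (u' t), dtg t⟫ ≤ ε * (‖L‖ * ‖u' t‖ * ‖dtg t‖) := by
              gcongr
              exact (real_inner_le_norm _ _).trans (by gcongr; exact L.le_opNorm _)
          _ = ‖L‖ * (ε * ‖u' t‖) * ‖dtg t‖ := by ring
          _ ≤ _ := by
              have := hK2 t ht
              have := hdtg t ht
              have : 0 ≤ K2 := le_trans (by positivity) (hK2 t ht)
              gcongr
      have b2 : ε * ⟪L (u' t), H t (u' t)⟫ ≤ ‖L‖ * Hb * ε * ‖u' t‖ ^ 2 := by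
        calc ε * ⟪L (u' t), H t (u' t)⟫ ≤ ε * ((‖L‖ * ‖u' t‖) * (Hb * ‖u' t‖)) := by
              gcongr
              refine (real_inner_le_norm _ _).trans ?_
              gcongr
              · exact L.le_opNorm _
              · exact (H t).le_of_opNorm_le (hH t ht) _
          _ = _ := by ring
      linarith)
  rw [intervalIntegral.integral_add, intervalIntegral.integral_add] at hle
  · simp only [intervalIntegral.integral_const_mul] at hle
    have hb : ∀ t ∈ Icc 0 T, |ε * ⟪L (u' t), g t⟫| ≤ ‖L‖ * (K2 * G) := by
      intro t ht
      rw [abs_mul, abs_of_pos hε]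
      calc ε * |⟪L (u' t), g t⟫| ≤ ε * (‖L‖ * ‖u' t‖ * ‖g t‖) := by
            gcongr
            exact (abs_real_inner_le_norm _ _).trans (by gcongr; exact L.le_opNorm _)
        _ = ‖L‖ * ((ε * ‖u' t‖) * ‖g t‖) := by ring
        _ ≤ _ := by
            have := hK2 t ht
            have := hG t ht
            have : 0 ≤ K2 := le_trans (by positivity) (hK2 t ht)
            gcongr
    have c1 := abs_le.1 (hb 0 h0)
    have c2 := abs_le.1 (hb T hTT)
    have c3 : ‖L‖ * Hb * (ε * ∫ t in (0:ℝ)..T, ‖u' t‖ ^ 2) ≤ ‖L‖ * Hb * K3 := by gcongr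
    nlinarith [c1.1, c1.2, c2.1, c2.2]
  all_goals
    rw [intervalIntegrable_iff_integrableOn_Icc_of_le hT.le]
  · exact ha.const_mul _
  · exact i2.const_mul _
  · exact i1.const_mul _
  · exact (ha.const_mul _).add (i2.const_mul _)

lemma aux_final {X : Type*} [NormedAddCommGroup X] [InnerProductSpace ℝ X]
    {T : ℝ} (hT : 0 < T) {A B : X →L[ℝ] X} {α : ℝ} (hα : 0 < α)
    (hA : ∀ x : X, α * ‖x‖ ^ 2 ≤ ⟪x, A x⟫) {u' u'' g : ℝ → X} {ε K3 Z : ℝ} (hε : 0 < ε)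
    (hu'c : ContinuousOn u' (Icc 0 T)) (hu''c : ContinuousOn u'' (Icc 0 T))
    (hgc : ContinuousOn g (Icc 0 T))
    (hode : ∀ t ∈ Set.Icc 0 T, ε ^ 2 • A (u'' t) + ε • B (u' t) + g t = 0)
    (hK3 : ε * ∫ t in (0:ℝ)..T, ‖u' t‖ ^ 2 ≤ K3)
    (hZ : -Z ≤ ε * ∫ t in (0:ℝ)..T, ⟪A (u'' t), g t⟫) :
    (1 / (2 * ε)) * (∫ r in (0 : ℝ)..T, ‖g r + ε ^ 2 • A (u'' r)‖ ^ 2) ≤ ‖B‖ ^ 2 / 2 * K3 ∧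
    (1 / (2 * ε)) * (∫ r in (0 : ℝ)..T, ‖g r‖ ^ 2) ≤ ‖B‖ ^ 2 / 2 * K3 + Z ∧
    ε ^ 3 * (∫ r in (0 : ℝ)..T, ‖u'' r‖ ^ 2) ≤ 2 * (‖B‖ ^ 2 / 2 * K3 + Z) / α ^ 2 := by
  have hint : ∀ f : ℝ → ℝ, ContinuousOn f (Icc 0 T) → IntervalIntegrable f volume 0 T := by
    intro f hf
    rw [← uIcc_of_le hT.le] at hf
    exact hf.intervalIntegrable
  have i1 : IntervalIntegrable (fun t => ‖g t‖ ^ 2) volume 0 T := hint _ (by fun_prop)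
  have i2 : IntervalIntegrable (fun t => ‖A (u'' t)‖ ^ 2) volume 0 T := hint _ (by fun_prop)
  have i3 : IntervalIntegrable (fun t => ⟪A (u'' t), g t⟫) volume 0 T := hint _ (by fun_prop)
  have i4 : IntervalIntegrable (fun t => ‖u' t‖ ^ 2) volume 0 T := hint _ (by fun_prop)
  have i5 : IntervalIntegrable (fun t => ‖u'' t‖ ^ 2) volume 0 T := hint _ (by fun_prop)
  have i6 : IntervalIntegrable (fun t => ‖g t + ε ^ 2 • A (u'' t)‖ ^ 2) volume 0 T :=
    hint _ (by fun_prop)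
  have hv : (1 / (2 * ε)) * (∫ r in (0 : ℝ)..T, ‖g r + ε ^ 2 • A (u'' r)‖ ^ 2) ≤
      ‖B‖ ^ 2 / 2 * K3 := by
    have h1 : (∫ r in (0 : ℝ)..T, ‖g r + ε ^ 2 • A (u'' r)‖ ^ 2) ≤
        ∫ r in (0 : ℝ)..T, (ε ^ 2 * ‖B‖ ^ 2) * ‖u' r‖ ^ 2 := by
      refine intervalIntegral.integral_mono_on hT.le i6 (i4.const_mul _) (fun t ht => ?_)
      have e : g t + ε ^ 2 • A (u'' t) = - (ε • B (u' t)) := by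
        rw [eq_neg_iff_add_eq_zero, ← hode t ht]; abel
      rw [e, norm_neg, norm_smul, Real.norm_of_nonneg hε.le]
      calc (ε * ‖B (u' t)‖) ^ 2 ≤ (ε * (‖B‖ * ‖u' t‖)) ^ 2 := by
            gcongr; exact B.le_opNorm _
        _ = _ := by ring
    rw [intervalIntegral.integral_const_mul] at h1
    calc _ ≤ (1 / (2 * ε)) * (ε ^ 2 * ‖B‖ ^ 2 * ∫ r in (0 : ℝ)..T, ‖u' r‖ ^ 2) := by gcongr
      _ = ‖B‖ ^ 2 / 2 * (ε * ∫ r in (0 : ℝ)..T, ‖u' r‖ ^ 2) := by field_simp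
      _ ≤ _ := by gcongr
  have hexp : (∫ r in (0 : ℝ)..T, ‖g r + ε ^ 2 • A (u'' r)‖ ^ 2) =
      (∫ r in (0 : ℝ)..T, ‖g r‖ ^ 2) + ε ^ 4 * (∫ r in (0 : ℝ)..T, ‖A (u'' r)‖ ^ 2) +
      2 * ε ^ 2 * ∫ r in (0 : ℝ)..T, ⟪A (u'' r), g r⟫ := by
    rw [← intervalIntegral.integral_const_mul, ← intervalIntegral.integral_const_mul,
      ← intervalIntegral.integral_add i1 (i2.const_mul _),
      ← intervalIntegral.integral_add (i1.add (i2.const_mul _)) (i3.const_mul _)]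
    congr 1
    ext r
    rw [norm_add_sq_real, norm_smul, inner_smul_right, real_inner_comm, Real.norm_of_nonneg
      (by positivity)]
    ring
  have hexp2 : (1 / (2 * ε)) * (∫ r in (0 : ℝ)..T, ‖g r + ε ^ 2 • A (u'' r)‖ ^ 2) =
      (1 / (2 * ε)) * (∫ r in (0 : ℝ)..T, ‖g r‖ ^ 2) +
      ε ^ 3 / 2 * (∫ r in (0 : ℝ)..T, ‖A (u'' r)‖ ^ 2) +
      ε * ∫ r in (0 : ℝ)..T, ⟪A (u'' r), g r⟫ := by
    rw [hexp]; field_simp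
  have p1 : 0 ≤ (1 / (2 * ε)) * (∫ r in (0 : ℝ)..T, ‖g r‖ ^ 2) :=
    mul_nonneg (by positivity) (intervalIntegral.integral_nonneg hT.le fun _ _ => by positivity)
  have p2 : 0 ≤ ε ^ 3 / 2 * (∫ r in (0 : ℝ)..T, ‖A (u'' r)‖ ^ 2) :=
    mul_nonneg (by positivity) (intervalIntegral.integral_nonneg hT.le fun _ _ => by positivity)
  refine ⟨hv, by linarith, ?_⟩
  have h3 : α ^ 2 * (∫ r in (0 : ℝ)..T, ‖u'' r‖ ^ 2) ≤ ∫ r in (0 : ℝ)..T, ‖A (u'' r)‖ ^ 2 := by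
    rw [← intervalIntegral.integral_const_mul]
    refine intervalIntegral.integral_mono_on hT.le (i5.const_mul _) i2 (fun t ht => ?_)
    have h4 : α * ‖u'' t‖ ≤ ‖A (u'' t)‖ := by
      by_cases hz : ‖u'' t‖ = 0
      · rw [hz]; simp
      have hp : 0 < ‖u'' t‖ := lt_of_le_of_ne (norm_nonneg _) (Ne.symm hz)
      have h5 := (hA (u'' t)).trans (real_inner_le_norm _ _)
      nlinarith
    rw [← mul_pow]
    gcongr
  rw [le_div_iff₀ (by positivity)]
  have h4 : ε ^ 3 * (α ^ 2 * (∫ r in (0 : ℝ)..T, ‖u'' r‖ ^ 2)) ≤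
      ε ^ 3 * ∫ r in (0 : ℝ)..T, ‖A (u'' r)‖ ^ 2 := by gcongr
  linarith

/-- A priori bounds (v)-(viii) for the solutions of the singularly perturbed problem. -/
theorem apriori_bounds_v_viii
    {X : Type*} [NormedAddCommGroup X] [InnerProductSpace ℝ X] [FiniteDimensional ℝ X]
    (A B : X →L[ℝ] X)
    (hAsymm : ∀ x y : X, ⟪A x, y⟫ = ⟪x, A y⟫)
    (hApos : ∀ x : X, x ≠ 0 → 0 < ⟪x, A x⟫)
    (hBsymm : ∀ x y : X, ⟪B x, y⟫ = ⟪x, B y⟫)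
    (hBpos : ∀ x : X, x ≠ 0 → 0 < ⟪x, B x⟫)
    (T : ℝ) (hT : 0 < T)
    (F dtF : ℝ → X → ℝ) (gradF : ℝ → X → X)
    -- (F0): F is C¹ on [0,T] × X
    (hF0 : ContDiffOn ℝ 1 (fun p : ℝ × X => F p.1 p.2) (Set.Icc 0 T ×ˢ Set.univ))
    (hgradF : ∀ t ∈ Set.Icc 0 T, ∀ x : X, HasGradientAt (F t) (gradF t x) x)
    (hdtF : ∀ x : X, ∀ t ∈ Set.Icc 0 T,
      HasDerivWithinAt (fun τ => F τ x) (dtF t x) (Set.Icc 0 T) t)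
    -- (F1)
    (hF1 : ∀ ρ > (0 : ℝ), Bornology.IsBounded {x : X | ∀ t ∈ Set.Icc 0 T, |F t x| ≤ ρ})
    -- (F2)
    (C₁ C₂ : ℝ) (hC₁ : 0 < C₁) (hC₂ : 0 < C₂)
    (hF2 : ∀ t ∈ Set.Icc 0 T, ∀ x : X, |dtF t x| ≤ C₁ * F t x + C₂)
    -- (F3): integrable bound on the mixed derivative ∂ₜ∇ₓF on bounded sets
    (dtgradF : ℝ → X → X)
    (hdtgradF : ∀ x : X, ∀ t ∈ Set.Icc 0 T,
      HasDerivWithinAt (fun τ => gradF τ x) (dtgradF t x) (Set.Icc 0 T) t)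
    (hF3 : ∀ M > (0 : ℝ), ∃ a : ℝ → ℝ, MeasureTheory.IntegrableOn a (Set.Icc 0 T) ∧
      ∀ t ∈ Set.Icc 0 T, ∀ x : X, ‖x‖ ≤ M → ‖dtgradF t x‖ ≤ a t)
    -- (F4)
    (hessF : ℝ → X → X →L[ℝ] X)
    (hF4 : ∀ t ∈ Set.Icc 0 T, ContDiff ℝ 2 (F t))
    (hhessF : ∀ t ∈ Set.Icc 0 T, ∀ x : X, HasFDerivAt (gradF t) (hessF t x) x)
    (hhessFc : ContinuousOn (fun p : ℝ × X => hessF p.1 p.2) (Set.Icc 0 T ×ˢ Set.univ))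
    -- the family of solutions u_ε, with derivatives u'_ε, u''_ε
    (u u' u'' : ℝ → ℝ → X)
    (hu' : ∀ ε > (0 : ℝ), ∀ t ∈ Set.Icc 0 T, HasDerivWithinAt (u ε) (u' ε t) (Set.Icc 0 T) t)
    (hu'' : ∀ ε > (0 : ℝ), ∀ t ∈ Set.Icc 0 T, HasDerivWithinAt (u' ε) (u'' ε t) (Set.Icc 0 T) t)
    (hu''c : ∀ ε > (0 : ℝ), ContinuousOn (u'' ε) (Set.Icc 0 T))
    (hode : ∀ ε > (0 : ℝ), ∀ t ∈ Set.Icc 0 T,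
      ε ^ 2 • A (u'' ε t) + ε • B (u' ε t) + gradF t (u ε t) = 0)
    -- uniformly bounded initial data
    (R : ℝ) (hR : 0 < R)
    (hinit : ∀ ε > (0 : ℝ), ‖u ε 0‖ ≤ R ∧ ε * ‖u' ε 0‖ ≤ R) :
    ∃ C > (0 : ℝ), ∀ ε > (0 : ℝ),
      (1 / (2 * ε)) * (∫ r in (0 : ℝ)..T, ‖gradF r (u ε r) + ε ^ 2 • A (u'' ε r)‖ ^ 2) ≤ C ∧
      ε * |∫ r in (0 : ℝ)..T, ⟪u'' ε r, gradF r (u ε r)⟫| ≤ C ∧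
      (1 / (2 * ε)) * (∫ r in (0 : ℝ)..T, ‖gradF r (u ε r)‖ ^ 2) ≤ C ∧
      ε ^ 3 * (∫ r in (0 : ℝ)..T, ‖u'' ε r‖ ^ 2) ≤ C := by
  have : ProperSpace X := FiniteDimensional.proper ℝ X
  obtain ⟨α, hα, hA⟩ := aux_coercive A hApos
  obtain ⟨β, hβ, hB⟩ := aux_coercive B hBpos
  have h0 : (0:ℝ) ∈ Icc 0 T := ⟨le_rfl, hT.le⟩
  have hc : 0 < C₂ / C₁ := div_pos hC₂ hC₁
  -- bound of the initial energy
  obtain ⟨F0, hF00⟩ := ((isCompact_closedBall (0:X) R).bddAbove_image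
    (f := F 0) ((hF4 0 h0).continuous.continuousOn))
  have hF00' : ∀ x : X, ‖x‖ ≤ R → F 0 x ≤ F0 := fun x hx =>
    hF00 ⟨x, by simpa using hx, rfl⟩
  obtain ⟨K, hK⟩ : ∃ K, K = (‖A‖ * R ^ 2 / 2 + F0 + C₂ / C₁) * Real.exp (C₁ * T) := ⟨_, rfl⟩
  have hen := fun (ε : ℝ) (hε : 0 < ε) => aux_energy hAsymm hα hβ hA hB hT hC₁ hF2 hε
    (fun t ht => aux_chain_F hT hF0 hgradF hdtF ht (hu' ε hε t ht)) (hu'' ε hε) (hode ε hε)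
    (hF00' _ (hinit ε hε).1) (hinit ε hε).2 hK
  -- bound of the solutions
  have hcF : ∀ t ∈ Icc 0 T, ∀ x, 0 ≤ F t x + C₂ / C₁ := by
    intro t ht x
    have h1 := (abs_nonneg _).trans (hF2 t ht x)
    have h2 : C₁ * F t x + C₂ = C₁ * (F t x + C₂ / C₁) := by field_simp
    rw [h2] at h1
    exact nonneg_of_mul_nonneg_right h1 hC₁
  have hK0 : 0 ≤ K := (hcF 0 h0 _).trans ((hen 1 one_pos).1 0 h0)
  have hgron : ∀ x : X, ∀ t ∈ Icc 0 T, ∀ s ∈ Icc 0 T,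
      F s x + C₂ / C₁ ≤ (F t x + C₂ / C₁) * Real.exp (C₁ * T) := by
    intro x t ht s hs
    have hd : ∀ r ∈ Icc 0 T, HasDerivWithinAt (fun r => F r x + C₂ / C₁) (dtF r x) (Icc 0 T) r :=
      fun r hr => (hdtF x r hr).add_const _
    have hb : ∀ r ∈ Icc 0 T, |dtF r x| ≤ C₁ * (F r x + C₂ / C₁) := by
      intro r hr
      have h2 : C₁ * F r x + C₂ = C₁ * (F r x + C₂ / C₁) := by field_simp
      rw [← h2]
      exact hF2 r hr x
    have hp := hcF t ht x
    rcases le_total t s with hts | hts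
    · refine (aux_decay (c := C₁) hd (fun r hr => (le_abs_self _).trans (hb r hr)) ht hs hts).trans
        ?_
      have : s - t ≤ T := by linarith [ht.1, hs.2]
      gcongr
    · have h1 := aux_decay (c := -C₁) (fun r hr => (hd r hr).neg)
        (fun r hr => by
          have := (neg_le_abs _).trans (hb r hr)
          simp only [Pi.neg_apply]
          linarith) hs ht hts
      simp only [Pi.neg_apply] at h1
      have h2 : F s x + C₂ / C₁ ≤ (F t x + C₂ / C₁) * Real.exp (C₁ * (t - s)) := by
        have e : F s x + C₂ / C₁ = (F s x + C₂ / C₁) * Real.exp (-C₁ * (t - s)) *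
            Real.exp (C₁ * (t - s)) := by
          rw [mul_assoc, ← Real.exp_add]; simp
        rw [e]
        gcongr
        linarith
      refine h2.trans ?_
      have : t - s ≤ T := by linarith [hs.1, ht.2]
      gcongr
  obtain ⟨M, hMpos, hM⟩ : ∃ M > (0:ℝ), ∀ ε > (0:ℝ), ∀ t ∈ Icc 0 T, ‖u ε t‖ ≤ M := by
    have hb := hF1 (K * Real.exp (C₁ * T) + C₂ / C₁) (by positivity)
    obtain ⟨M, hM0, hM⟩ := hb.exists_pos_norm_le
    refine ⟨M, hM0, fun ε hε t ht => hM _ (fun s hs => ?_)⟩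
    have h1 := hgron (u ε t) t ht s hs
    have h2 := (hen ε hε).1 t ht
    have h3 : (F t (u ε t) + C₂ / C₁) * Real.exp (C₁ * T) ≤ K * Real.exp (C₁ * T) := by gcongr
    have h4 := hcF s hs (u ε t)
    have h5 : 0 ≤ K * Real.exp (C₁ * T) := by positivity
    rw [abs_le]
    constructor <;> linarith
  -- bounds of the data on the ball of radius `M`
  obtain ⟨a, ha, hdtg⟩ := hF3 M hMpos
  obtain ⟨Hb, hHb0, hHb⟩ : ∃ Hb ≥ (0:ℝ), ∀ t ∈ Icc 0 T, ∀ x : X, ‖x‖ ≤ M → ‖hessF t x‖ ≤ Hb := by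
    obtain ⟨C, hC⟩ := (isCompact_Icc.prod (isCompact_closedBall (0:X) M)).exists_bound_of_continuousOn
      (hhessFc.mono (prod_mono_right (subset_univ _)))
    refine ⟨max C 0, le_max_right _ _, fun t ht x hx => (hC (t, x) ⟨ht, ?_⟩).trans (le_max_left _ _)⟩
    simpa using hx
  obtain ⟨G, hG⟩ : ∃ G, ∀ t ∈ Icc 0 T, ∀ x : X, ‖x‖ ≤ M → ‖gradF t x‖ ≤ G := by
    obtain ⟨C, hC⟩ := isCompact_Icc.exists_bound_of_continuousOn
      (f := fun t => gradF t 0) (s := Icc 0 T)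
      (fun t ht => (hdtgradF 0 t ht).continuousWithinAt)
    refine ⟨C + Hb * M, fun t ht x hx => ?_⟩
    have h1 := (convex_closedBall (0:X) M).norm_image_sub_le_of_norm_hasFDerivWithin_le (𝕜 := ℝ)
      (f := gradF t) (f' := hessF t) (C := Hb) (x := 0) (y := x)
      (fun x _ => (hhessF t ht x).hasFDerivWithinAt)
      (fun x hx => hHb t ht x (by simpa using hx)) (by simpa using hMpos.le) (by simpa using hx)
    rw [sub_zero] at h1
    have h2 : Hb * ‖x‖ ≤ Hb * M := by gcongr
    have h3 := norm_le_norm_add_norm_sub' (gradF t x) (gradF t 0)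
    linarith [hC t ht]
  obtain ⟨K2, hK2⟩ : ∃ K2, ∀ ε > (0:ℝ), ∀ t ∈ Icc 0 T, ε * ‖u' ε t‖ ≤ K2 := by
    refine ⟨Real.sqrt (2 * K / α), fun ε hε t ht => (le_abs_self _).trans (Real.abs_le_sqrt ?_)⟩
    rw [le_div_iff₀ hα]
    linarith [(hen ε hε).2.1 t ht]
  obtain ⟨K3, hK3⟩ : ∃ K3, ∀ ε > (0:ℝ), ε * ∫ t in (0:ℝ)..T, ‖u' ε t‖ ^ 2 ≤ K3 := by
    refine ⟨(K + T * (C₁ * K)) / β, fun ε hε => ?_⟩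
    rw [le_div_iff₀ hβ]
    linarith [(hen ε hε).2.2]
  have hchain : ∀ ε > (0:ℝ), ∀ t ∈ Icc 0 T, HasDerivWithinAt (fun s => gradF s (u ε s))
      (dtgradF t (u ε t) + hessF t (u ε t) (u' ε t)) (Icc 0 T) t := fun ε hε t ht =>
    aux_chain_grad hdtgradF hhessF hhessFc ht (hu' ε hε t ht)
  obtain ⟨N, hN⟩ : ∃ N, N = 2 * (K2 * G) + K2 * (∫ t in (0:ℝ)..T, a t) + Hb * K3 := ⟨_, rfl⟩
  have hlow : ∀ ε > (0:ℝ), ∀ L : X →L[ℝ] X,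
      -(‖L‖ * N) ≤ ε * ∫ t in (0:ℝ)..T, ⟪L (u'' ε t), gradF t (u ε t)⟫ := by
    intro ε hε L
    rw [hN]
    exact aux_lower hT ha (fun t ht => hdtg t ht _ (hM ε hε t ht)) hε
      (fun t ht => hG t ht _ (hM ε hε t ht)) (fun t ht => hHb t ht _ (hM ε hε t ht)) hHb0
      (hchain ε hε) (hu'' ε hε) (hu''c ε hε) (hK2 ε hε) (hK3 ε hε) L
  obtain ⟨V, hV⟩ : ∃ V, V = ‖B‖ ^ 2 / 2 * K3 := ⟨_, rfl⟩
  obtain ⟨W, hW⟩ : ∃ W, W = ‖ContinuousLinearMap.id ℝ X‖ * N := ⟨_, rfl⟩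
  have q1 := abs_nonneg V
  have q2 := abs_nonneg W
  have q3 := abs_nonneg (V + ‖A‖ * N)
  have q4 := abs_nonneg (2 * (V + ‖A‖ * N) / α ^ 2)
  refine ⟨1 + |V| + |W| + |V + ‖A‖ * N| + |2 * (V + ‖A‖ * N) / α ^ 2|, by positivity,
    fun ε hε => ?_⟩
  obtain ⟨f1, f2, f3⟩ := aux_final hT hα hA hε
    (fun t ht => (hu'' ε hε t ht).continuousWithinAt) (hu''c ε hε)
    (fun t ht => (hchain ε hε t ht).continuousWithinAt) (hode ε hε) (hK3 ε hε) (hlow ε hε A)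
  rw [← hV] at f1 f2 f3
  have w1 := hlow ε hε (ContinuousLinearMap.id ℝ X)
  have w2 := hlow ε hε (-ContinuousLinearMap.id ℝ X)
  rw [norm_neg] at w2
  simp only [ContinuousLinearMap.neg_apply, ContinuousLinearMap.id_apply, inner_neg_left,
    intervalIntegral.integral_neg] at w1 w2
  rw [← hW] at w1 w2
  have f4 : ε * |∫ r in (0 : ℝ)..T, ⟪u'' ε r, gradF r (u ε r)⟫| ≤ W := by
    rw [← abs_of_pos hε, ← abs_mul, abs_of_pos hε, abs_le]
    constructor <;> linarith
  have r1 := le_abs_self V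
  have r2 := le_abs_self W
  have r3 := le_abs_self (V + ‖A‖ * N)
  have r4 := le_abs_self (2 * (V + ‖A‖ * N) / α ^ 2)
  exact ⟨by linarith, by linarith, by linarith, by linarith⟩
end

section
/- Assume (F0)-(F6), with (F3') in place of (F3). For each ε > 0 let u_ε : [0,T] → X be a C² solution of ε² A ü_ε(t) + ε B u̇_ε(t) + ∇ₓF(t, u_ε(t)) = 0 with u_ε(0) uniformly bounded and ε u̇_ε(0) → 0, and suppose u_ε(t) → u(t) pointwise as ε → 0, where u : [0,T] → X is regulated with jump set J and satisfies ∇ₓF(t, u₊(t)) = ∇ₓF(t, u₋(t)) = 0 for every t ∈ (0,T]. Then there exists a positive atomic measure μ on [0,T] with support equal to J such that F(t, u₊(t)) + μ([s,t]) = F(s, u₋(s)) + ∫_s^t ∂_r F(r, u(r)) dr for all 0 ≤ s ≤ t ≤ T (with the conventions u₋(0) := u(0) and u₊(T) := u(T)). -/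
open Set Filter Topology MeasureTheory
open scoped RealInnerProductSpace

/-- Finite sums of jumps of a monotone function. -/
lemma jump_finsum_lt {T : ℝ} {P M : ℝ → ℝ}
    (hMP : ∀ s ∈ Icc 0 T, M s ≤ P s)
    (hPM : ∀ s t, 0 ≤ s → s < t → t ≤ T → P s ≤ M t)
    {s : ℝ} (hs : 0 ≤ s) (S : Finset ℝ) :
    ∀ m, s ≤ m → m ≤ T → (∀ x ∈ S, s ≤ x ∧ x < m) → ∑ x ∈ S, (P x - M x) ≤ M m - M s := by
  induction S using Finset.induction_on_max with
  | empty =>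
    intro m hsm hmT _
    simp only [Finset.sum_empty]
    rcases hsm.eq_or_lt with h | h
    · simp [h]
    · have h1 := hPM s m hs h hmT
      have h2 := hMP s ⟨hs, by linarith⟩
      linarith
  | insert a S hlt ih =>
    intro m hsm hmT hx
    have ha := hx a (Finset.mem_insert_self _ _)
    rw [Finset.sum_insert (fun h => lt_irrefl _ (hlt a h))]
    have h1 := ih a ha.1 (by linarith) (fun x hxS => ⟨(hx x (Finset.mem_insert_of_mem hxS)).1, hlt x hxS⟩)
    have h2 := hPM a m (by linarith) ha.2 hmT
    linarith

lemma jump_finsum_le {T : ℝ} {P M : ℝ → ℝ}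
    (hMP : ∀ s ∈ Icc 0 T, M s ≤ P s)
    (hPM : ∀ s t, 0 ≤ s → s < t → t ≤ T → P s ≤ M t)
    {s t : ℝ} (hs : 0 ≤ s) (hst : s ≤ t) (htT : t ≤ T) (S : Finset ℝ)
    (hS : ∀ x ∈ S, s ≤ x ∧ x ≤ t) : ∑ x ∈ S, (P x - M x) ≤ P t - M s := by
  have h1 := jump_finsum_lt hMP hPM hs (S.erase t) t hst htT (by
    intro x hx
    rw [Finset.mem_erase] at hx
    exact ⟨(hS x hx.2).1, lt_of_le_of_ne (hS x hx.2).2 hx.1⟩)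
  have h3 := hMP t ⟨by linarith, htT⟩
  by_cases h : t ∈ S
  · rw [← Finset.add_sum_erase S _ h]
    linarith
  · rw [Finset.erase_eq_of_notMem h] at h1
    linarith

/-- A monotone function with vanishing right Dini derivative is the distribution function of a
purely atomic measure. -/
lemma jump_measure {T : ℝ} {P M : ℝ → ℝ} {J : Set ℝ}
    (hMP : ∀ s ∈ Icc 0 T, M s ≤ P s)
    (hPM : ∀ s t, 0 ≤ s → s < t → t ≤ T → P s ≤ M t)
    (hleft : ∀ t ∈ Ioc 0 T, Tendsto P (𝓝[<] t) (𝓝 (M t)))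
    (hdini : ∀ s ∈ Ico 0 T, ∀ δ > (0 : ℝ), ∀ᶠ t in 𝓝[>] s, P t - P s ≤ δ * (t - s))
    (hJ : ∀ t, t ∈ J ↔ t ∈ Icc 0 T ∧ M t < P t) :
    ∃ μ : Measure ℝ,
      (∀ s : Set ℝ, MeasurableSet s → μ s = ∑' t : ↥(s ∩ J), μ {(t : ℝ)}) ∧
      (∀ t : ℝ, μ {t} ≠ 0 ↔ t ∈ J) ∧
      (∀ s t : ℝ, 0 ≤ s → s ≤ t → t ≤ T → (μ (Icc s t)).toReal = P t - M s) := by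
  classical
  let w : ℝ → ENNReal := J.indicator (fun x => ENNReal.ofReal (P x - M x))
  let μ : Measure ℝ := Measure.sum (fun x : ℝ => w x • Measure.dirac x)
  have hμ : ∀ s, MeasurableSet s → μ s = ∑' x : ℝ, s.indicator w x := by
    intro s hs
    rw [Measure.sum_apply _ hs]
    refine tsum_congr fun x => ?_
    rw [Measure.smul_apply, Measure.dirac_apply' _ hs]
    by_cases h : x ∈ s <;> simp [h]
  have hμ1 : ∀ x, μ {x} = w x := by
    intro x
    rw [hμ _ (measurableSet_singleton x), tsum_eq_single x]
    · simp
    · intro y hy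
      simp [hy]
  have hwJ : ∀ x ∈ Icc 0 T, w x = ENNReal.ofReal (P x - M x) := by
    intro x hx
    by_cases h : x ∈ J
    · simp [w, h]
    · have h2 : ¬ M x < P x := fun h' => h ((hJ x).2 ⟨hx, h'⟩)
      simp only [w, indicator_of_notMem h]
      rw [ENNReal.ofReal_of_nonpos]
      linarith
  -- upper bound
  have hup : ∀ s t : ℝ, 0 ≤ s → s ≤ t → t ≤ T → μ (Icc s t) ≤ ENNReal.ofReal (P t - M s) := by
    intro s t hs hst htT
    rw [hμ _ measurableSet_Icc, ENNReal.tsum_eq_iSup_sum]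
    refine iSup_le fun S => ?_
    have h1 : ∑ x ∈ S, (Icc s t).indicator w x
        = ∑ x ∈ S.filter (fun x => x ∈ Icc s t), ENNReal.ofReal (P x - M x) := by
      rw [Finset.sum_filter]
      refine Finset.sum_congr rfl fun x _ => ?_
      by_cases hx : x ∈ Icc s t
      · rw [indicator_of_mem hx, if_pos hx, hwJ x ⟨hs.trans hx.1, hx.2.trans htT⟩]
      · rw [indicator_of_notMem hx, if_neg hx]
    rw [h1, ← ENNReal.ofReal_sum_of_nonneg]
    · apply ENNReal.ofReal_le_ofReal
      apply jump_finsum_le hMP hPM hs hst htT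
      intro x hx
      exact (Finset.mem_filter.1 hx).2
    · intro x hx
      have hx := (Finset.mem_filter.1 hx).2
      have := hMP x ⟨hs.trans hx.1, hx.2.trans htT⟩
      linarith
  have hfin : ∀ s t : ℝ, 0 ≤ s → s ≤ t → t ≤ T → μ (Icc s t) ≠ ⊤ := fun s t h1 h2 h3 =>
    ne_top_of_le_ne_top ENNReal.ofReal_ne_top (hup s t h1 h2 h3)
  have hmono : ∀ s t, 0 ≤ s → s ≤ t → t ≤ T → P s ≤ P t := by
    intro s t hs hst ht
    rcases hst.eq_or_lt with h | h
    · rw [h]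
    · exact (hPM s t hs h ht).trans (hMP t ⟨by linarith, ht⟩)
  -- lower bound
  have hlow : ∀ s, 0 ≤ s → ∀ δ > (0 : ℝ), ∀ t, s ≤ t → t ≤ T →
      P t ≤ M s + (μ (Icc s t)).toReal + δ * (t - s) := by
    intro s hs δ hδ
    by_contra hcon
    push Not at hcon
    obtain ⟨t₀, hst₀, ht₀T, hbad⟩ := hcon
    have hmonoμ : ∀ r t, s ≤ r → r ≤ t → t ≤ T → (μ (Icc s r)).toReal ≤ (μ (Icc s t)).toReal := by
      intro r t h1 h2 h3
      exact ENNReal.toReal_mono (hfin s t hs (h1.trans h2) h3) (measure_mono (Icc_subset_Icc_right h2))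
    have haddμ : ∀ r t, s ≤ r → r < t → t ≤ T →
        (μ (Icc s r)).toReal + (P t - M t) ≤ (μ (Icc s t)).toReal := by
      intro r t h1 h2 h3
      have e : μ (Icc s r) + μ {t} ≤ μ (Icc s t) := by
        rw [← measure_union (by simp [h2]) (measurableSet_singleton t)]
        apply measure_mono
        rintro x (hx | hx)
        · exact ⟨hx.1, hx.2.trans h2.le⟩
        · rw [mem_singleton_iff.1 hx]; exact ⟨h1.trans h2.le, le_rfl⟩
      rw [hμ1, hwJ t ⟨by linarith, h3⟩] at e
      have e2 := ENNReal.toReal_mono (hfin s t hs (h1.trans h2.le) h3) e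
      rwa [ENNReal.toReal_add (hfin s r hs h1 (by linarith)) ENNReal.ofReal_ne_top,
        ENNReal.toReal_ofReal (by linarith [hMP t ⟨by linarith, h3⟩])] at e2
    let S : Set ℝ := {t | t ∈ Icc s T ∧ ∀ r ∈ Icc s t, P r ≤ M s + (μ (Icc s r)).toReal + δ * (r - s)}
    have hsT : s ≤ T := hst₀.trans ht₀T
    have hsS : s ∈ S := by
      refine ⟨⟨le_rfl, hsT⟩, ?_⟩
      intro r hr
      have : r = s := le_antisymm hr.2 hr.1
      subst this
      rw [Icc_self, hμ1, hwJ r ⟨hs, hsT⟩, ENNReal.toReal_ofReal (by linarith [hMP r ⟨hs, hsT⟩])]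
      linarith
    have hbdd : BddAbove S := ⟨T, fun x hx => hx.1.2⟩
    set c := sSup S with hc
    have hsc : s ≤ c := le_csSup hbdd hsS
    have hcT : c ≤ T := csSup_le ⟨s, hsS⟩ fun x hx => hx.1.2
    have hlt : ∀ r, s ≤ r → r < c → P r ≤ M s + (μ (Icc s r)).toReal + δ * (r - s) := by
      intro r h1 h2
      obtain ⟨y, hy, hry⟩ := exists_lt_of_lt_csSup ⟨s, hsS⟩ h2
      exact hy.2 r ⟨h1, hry.le⟩
    have hcP : P c ≤ M s + (μ (Icc s c)).toReal + δ * (c - s) := by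
      rcases hsc.eq_or_lt with h | h
      · have := hsS.2 s ⟨le_rfl, le_rfl⟩
        rwa [← h]
      · have hM : M c ≤ M s + ((μ (Icc s c)).toReal - (P c - M c)) + δ * (c - s) := by
          refine le_of_tendsto (hleft c ⟨by linarith, hcT⟩) ?_
          filter_upwards [Ioo_mem_nhdsLT h] with r hr
          have h1 := hlt r hr.1.le hr.2
          have h2 := haddμ r c hr.1.le hr.2 hcT
          have h3 : δ * (r - s) ≤ δ * (c - s) := by
            apply mul_le_mul_of_nonneg_left _ hδ.le
            linarith [hr.2]
          linarith
        linarith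
    have hct : c < t₀ := by
      by_contra h
      push Not at h
      rcases h.eq_or_lt with h | h
      · rw [← h] at hcP; linarith
      · linarith [hlt t₀ hst₀ h]
    have hcT' : c < T := by linarith
    have hev := hdini c ⟨by linarith, hcT'⟩ δ hδ
    obtain ⟨d, hd, hd2⟩ := (mem_nhdsGT_iff_exists_Ioo_subset' hcT').1 hev
    have hd : c < d := hd
    set e := min ((c + d) / 2) T with he
    have hce : c < e := lt_min (by linarith) hcT'
    have hed : e < d := (min_le_left _ _).trans_lt (by linarith)
    have heS : e ∈ S := by
      refine ⟨⟨by linarith, min_le_right _ _⟩, ?_⟩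
      intro r hr
      rcases lt_or_ge r c with h | h
      · exact hlt r hr.1 h
      rcases h.eq_or_lt with h | h
      · rw [← h]; exact hcP
      · have h1 : P r - P c ≤ δ * (r - c) := hd2 ⟨h, hr.2.trans_lt hed⟩
        have h2 := hmonoμ c r hsc h.le (hr.2.trans (min_le_right _ _))
        linarith
    exact absurd (le_csSup hbdd heS) (not_le.2 hce)
  refine ⟨μ, ?_, ?_, ?_⟩
  · intro s hs
    simp_rw [hμ1]
    rw [hμ s hs, tsum_subtype (s ∩ J) w]
    refine tsum_congr fun x => ?_
    by_cases h1 : x ∈ s <;> by_cases h2 : x ∈ J <;> simp [h1, h2, w]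
  · intro t
    rw [hμ1]
    by_cases h : t ∈ J
    · have := ((hJ t).1 h).2
      simp [w, h, this]
    · simp [w, h]
  · intro s t hs hst ht
    apply le_antisymm
    · have := ENNReal.toReal_mono ENNReal.ofReal_ne_top (hup s t hs hst ht)
      rwa [ENNReal.toReal_ofReal] at this
      have h1 := hMP s ⟨hs, hst.trans ht⟩
      have h2 := hmono s t hs hst ht
      linarith
    · have key : ∀ δ > (0 : ℝ), P t - M s ≤ (μ (Icc s t)).toReal + δ := by
        intro δ hδ
        have h0 : (0 : ℝ) < t - s + 1 := by linarith
        have h1 := hlow s hs (δ / (t - s + 1)) (by positivity) t hst ht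
        have h2 : δ / (t - s + 1) * (t - s) ≤ δ := by
          rw [div_mul_eq_mul_div, div_le_iff₀ h0]
          nlinarith
        linarith
      exact le_of_forall_pos_le_add key

lemma le_of_hasDerivWithinAt_nonpos {f f' : ℝ → ℝ} {a b : ℝ} (hab : a ≤ b)
    (h : ∀ x ∈ Icc a b, HasDerivWithinAt f (f' x) (Icc a b) x)
    (hn : ∀ x ∈ Icc a b, f' x ≤ 0) : f b ≤ f a := by
  have hanti : AntitoneOn f (Icc a b) := by
    have hd : ∀ x ∈ interior (Icc a b), HasDerivAt f (f' x) x := by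
      intro x hx
      have hx' := interior_subset hx
      exact (h x hx').hasDerivAt (mem_interior_iff_mem_nhds.1 hx)
    refine antitoneOn_of_deriv_nonpos (convex_Icc a b) (fun x hx => (h x hx).continuousWithinAt) ?_ ?_
    · intro x hx
      exact (hd x hx).differentiableAt.differentiableWithinAt
    · intro x hx
      rw [(hd x hx).deriv]
      exact hn x (interior_subset hx)
  exact hanti ⟨le_rfl, hab⟩ ⟨hab, le_rfl⟩ hab

section cross
variable {X : Type*} [NormedAddCommGroup X] [InnerProductSpace ℝ X]

/-- A path with small dissipation does not move much in a time of order `ε`. -/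
lemma small_move {v v' : ℝ → X} {D D' : ℝ → ℝ} {a b ε β w : ℝ} (hab : a ≤ b) (hε : 0 < ε)
    (hβ : 0 < β) (hw : 0 < w) (hbε : b - a ≤ ε)
    (hv : ∀ x ∈ Icc a b, HasDerivWithinAt v (v' x) (Icc a b) x)
    (hD : ∀ x ∈ Icc a b, HasDerivWithinAt D (D' x) (Icc a b) x)
    (hDv : ∀ x ∈ Icc a b, ε * β * ‖v' x‖ ^ 2 ≤ D' x)
    (hs : D b - D a ≤ β * w ^ 2) : ‖v b - v a‖ ≤ w := by
  have hI : ∀ x ∈ Ico a b, Icc a b ∈ 𝓝[≥] x := fun x hx => Icc_mem_nhdsGE_of_mem hx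
  have key := image_norm_le_of_norm_deriv_right_le_deriv_boundary' (a := a) (b := b)
    (f := fun x => v x - v a) (f' := v')
    (B := fun x => (D x - D a) / (2 * w * β) + w / (2 * ε) * (x - a))
    (B' := fun x => D' x / (2 * w * β) + w / (2 * ε))
    (fun x hx => ((hv x hx).sub_const _).continuousWithinAt)
    (fun x hx => ((hv x (Ico_subset_Icc_self hx)).sub_const _).mono_of_mem_nhdsWithin (hI x hx))
    (by simp)
    (fun x hx => by
      have h1 := (hD x hx).continuousWithinAt
      fun_prop)
    (fun x hx => by
      have h1 := (hD x (Ico_subset_Icc_self hx)).mono_of_mem_nhdsWithin (hI x hx)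
      have h2 := ((h1.sub_const (D a)).div_const (2 * w * β)).add
        ((((hasDerivAt_id x).sub_const a).const_mul (w / (2 * ε))).hasDerivWithinAt (s := Ici x))
      refine (h2.congr_deriv ?_)
      simp)
    (fun x hx => by
      have h1 := hDv x (Ico_subset_Icc_self hx)
      have h2 : ε * β * ‖v' x‖ ^ 2 / (2 * w * β) ≤ D' x / (2 * w * β) := by gcongr
      have h3 : ‖v' x‖ ≤ ε * β * ‖v' x‖ ^ 2 / (2 * w * β) + w / (2 * ε) := by
        have e : ε * β * ‖v' x‖ ^ 2 / (2 * w * β) + w / (2 * ε) - ‖v' x‖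
            = (ε * ‖v' x‖ - w) ^ 2 / (2 * w * ε) := by
          field_simp
          ring
        have : 0 ≤ (ε * ‖v' x‖ - w) ^ 2 / (2 * w * ε) := by positivity
        linarith
      linarith)
  have h := key (x := b) ⟨hab, le_rfl⟩
  refine h.trans ?_
  have e1 : (D b - D a) / (2 * w * β) ≤ w / 2 := by
    rw [div_le_iff₀ (by positivity)]
    nlinarith
  have e2 : w / (2 * ε) * (b - a) ≤ w / 2 := by
    calc w / (2 * ε) * (b - a) ≤ w / (2 * ε) * ε := by gcongr
      _ = w / 2 := by field_simp
  linarith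

/-- The force cannot stay away from zero for a time `ε` without moving the path. -/
lemma force_move (A B : X →L[ℝ] X) {v v' v'' : ℝ → X} {a c ε w m : ℝ} {e : X}
    (hε : 0 < ε) (hc : c = a + ε)
    (hv : ∀ x ∈ Icc a c, HasDerivWithinAt v (v' x) (Icc a c) x)
    (hv' : ∀ x ∈ Icc a c, HasDerivWithinAt v' (v'' x) (Icc a c) x)
    (hw : ∀ x ∈ Icc a c, ‖v x - v c‖ ≤ w)
    (hm : ∀ x ∈ Icc a c, ε ^ 2 * ⟪A (v'' x), e⟫ + ε * ⟪B (v' x), e⟫ ≤ - m) :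
    m / 6 ≤ ‖e‖ * w * (3 * ‖A‖ + ‖B‖) := by
  have hac : a ≤ c := by linarith
  have hbd : ∀ L : X →L[ℝ] X, ∀ x ∈ Icc a c, |⟪L (v x - v c), e⟫| ≤ ‖L‖ * w * ‖e‖ := by
    intro L x hx
    refine (abs_real_inner_le_norm _ _).trans ?_
    have h1 : ‖L (v x - v c)‖ ≤ ‖L‖ * w := L.le_opNorm_of_le (hw x hx)
    gcongr
  set C := ε ^ 2 * (‖e‖ * w * (2 * ‖A‖ + ‖B‖)) with hC
  have key := le_of_hasDerivWithinAt_nonpos (a := a) (b := c) hac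
    (f := fun r => ε ^ 2 * (((r - a) * (c - r)) * ⟪A (v' r), e⟫)
      - ε ^ 2 * ((a + c - 2 * r) * ⟪A (v r - v c), e⟫)
      + ε * (((r - a) * (c - r)) * ⟪B (v r - v c), e⟫)
      + m * (- r ^ 3 / 3 + (a + c) * r ^ 2 / 2 - a * c * r) - C * r)
    (f' := fun r => ε ^ 2 * ((a + c - 2 * r) * ⟪A (v' r), e⟫ + ((r - a) * (c - r)) * ⟪A (v'' r), e⟫)
      - ε ^ 2 * ((-2) * ⟪A (v r - v c), e⟫ + (a + c - 2 * r) * ⟪A (v' r), e⟫)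
      + ε * ((a + c - 2 * r) * ⟪B (v r - v c), e⟫ + ((r - a) * (c - r)) * ⟪B (v' r), e⟫)
      + m * ((r - a) * (c - r)) - C) ?_ ?_
  · have h1 := hbd A a ⟨le_rfl, hac⟩
    have h2 := (abs_le.1 h1).1
    simp only [sub_self, map_zero, inner_zero_left, mul_zero, zero_mul] at key
    have e1 : a + c - 2 * a = ε := by linarith
    have e2 : C * c = C * a + C * ε := by rw [hc]; ring
    have e3 : m * (-c ^ 3 / 3 + (a + c) * c ^ 2 / 2 - a * c * c)
      = m * (-a ^ 3 / 3 + (a + c) * a ^ 2 / 2 - a * c * a) + m * ε ^ 3 / 6 := by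
      rw [hc]; ring
    rw [e1, e2, e3] at key
    have h3 : ε ^ 3 * (m / 6) ≤ ε ^ 3 * (‖e‖ * w * (3 * ‖A‖ + ‖B‖)) := by
      have h4 : ε ^ 3 * (-(‖A‖ * w * ‖e‖)) ≤ ε ^ 3 * ⟪A (v a - v c), e⟫ := by gcongr
      rw [hC] at key
      nlinarith
    exact le_of_mul_le_mul_left h3 (by positivity)
  · intro r hr
    have hin : ∀ (L : X →L[ℝ] X) {f : ℝ → X} {f' : X}, HasDerivWithinAt f f' (Icc a c) r →
        HasDerivWithinAt (fun r => ⟪L (f r), e⟫) ⟪L f', e⟫ (Icc a c) r := by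
      intro L f f' hf
      have h1 : HasDerivWithinAt (fun r => L (f r)) (L f') (Icc a c) r :=
        L.hasFDerivAt.comp_hasDerivWithinAt r hf
      have := h1.inner ℝ (hasDerivWithinAt_const r (Icc a c) e)
      simpa using this
    have d1 := hin A (hv' r hr)
    have d2 := hin A ((hv r hr).sub_const (v c))
    have d3 := hin B ((hv r hr).sub_const (v c))
    have p1 : HasDerivWithinAt (fun r : ℝ => (r - a) * (c - r)) (a + c - 2 * r) (Icc a c) r := by
      have := ((hasDerivAt_id r).sub_const a).mul ((hasDerivAt_id r).const_sub c)
      refine (this.congr_deriv ?_).hasDerivWithinAt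
      simp only [id]; ring
    have p2 : HasDerivWithinAt (fun r : ℝ => a + c - 2 * r) (-2) (Icc a c) r := by
      have := ((hasDerivAt_id r).const_mul 2).const_sub (a + c)
      refine (this.congr_deriv ?_).hasDerivWithinAt
      ring
    have p3 : HasDerivWithinAt (fun r : ℝ => - r ^ 3 / 3 + (a + c) * r ^ 2 / 2 - a * c * r)
        ((r - a) * (c - r)) (Icc a c) r := by
      have h1 := ((hasDerivAt_pow 3 r).neg.div_const 3)
      have h2 := (((hasDerivAt_pow 2 r).const_mul (a + c)).div_const 2)
      have h3 := (hasDerivAt_id r).const_mul (a * c)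
      have := (h1.add h2).sub h3
      refine (this.congr_deriv ?_).hasDerivWithinAt
      simp; ring
    have p4 : HasDerivWithinAt (fun r : ℝ => C * r) C (Icc a c) r := by
      have := (hasDerivAt_id r).const_mul C
      refine (this.congr_deriv ?_).hasDerivWithinAt
      ring
    exact (((((p1.mul d1).const_mul (ε ^ 2)).sub ((p2.mul d2).const_mul (ε ^ 2))).add
      ((p1.mul d3).const_mul ε)).add (p3.const_mul m)).sub p4
  · intro r hr
    have h1 := (abs_le.1 (hbd A r hr)).2
    have h2 := hbd B r hr
    have h3 := hm r hr
    have hφ : 0 ≤ (r - a) * (c - r) := mul_nonneg (by linarith [hr.1]) (by linarith [hr.2])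
    have hφ' : |a + c - 2 * r| ≤ ε := by
      rw [abs_le]; constructor <;> linarith [hr.1, hr.2]
    have h4 : (a + c - 2 * r) * ⟪B (v r - v c), e⟫ ≤ ε * (‖B‖ * w * ‖e‖) := by
      refine (le_abs_self _).trans ?_
      rw [abs_mul]
      gcongr
    have h5 : ((r - a) * (c - r)) * (ε ^ 2 * ⟪A (v'' r), e⟫ + ε * ⟪B (v' r), e⟫ + m) ≤ 0 :=
      mul_nonpos_of_nonneg_of_nonpos hφ (by linarith)
    have h6 : ε * ((a + c - 2 * r) * ⟪B (v r - v c), e⟫) ≤ ε * (ε * (‖B‖ * w * ‖e‖)) := by gcongr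
    have h7 : ε ^ 2 * ⟪A (v r - v c), e⟫ ≤ ε ^ 2 * (‖A‖ * w * ‖e‖) := by gcongr
    rw [hC]
    nlinarith

/-- Crossing the sphere of radius `ρ` around `p` costs a fixed amount of energy. -/
lemma cross_cost [FiniteDimensional ℝ X] (A B : X →L[ℝ] X) {T : ℝ} {gradF : ℝ → X → X}
    (hgc : ContinuousOn (fun q : ℝ × X => gradF q.1 q.2) (Icc 0 T ×ˢ univ))
    {t : ℝ} (ht : t ∈ Icc 0 T) {p : X} {ρ β : ℝ} (hρ : 0 < ρ) (hβ : 0 < β)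
    (hcrit : ∀ x, ‖x - p‖ = ρ → gradF t x ≠ 0) :
    ∃ c > (0 : ℝ), ∃ δ > (0 : ℝ), ∀ ε > (0 : ℝ), ∀ a b : ℝ, 0 ≤ a → a ≤ b → b ≤ T →
      t - δ < a → b < t + δ → ∀ (v v' v'' : ℝ → X) (D D' : ℝ → ℝ),
      (∀ x ∈ Icc 0 T, HasDerivWithinAt v (v' x) (Icc 0 T) x) →
      (∀ x ∈ Icc 0 T, HasDerivWithinAt v' (v'' x) (Icc 0 T) x) →
      (∀ x ∈ Icc 0 T, ε ^ 2 • A (v'' x) + ε • B (v' x) + gradF x (v x) = 0) →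
      (∀ x ∈ Icc 0 T, HasDerivWithinAt D (D' x) (Icc 0 T) x) →
      (∀ x ∈ Icc 0 T, ε * β * ‖v' x‖ ^ 2 ≤ D' x) →
      ρ ∈ uIcc ‖v a - p‖ ‖v b - p‖ → ρ / 2 ≤ |‖v a - p‖ - ρ| → c ≤ D b - D a := by
  -- lower bound of the force on the sphere
  obtain ⟨κ, hκ, hκs⟩ : ∃ κ > (0 : ℝ), ∀ x, ‖x - p‖ = ρ → κ ≤ ‖gradF t x‖ := by
    have hcomp : IsCompact (Metric.sphere p ρ) := isCompact_sphere p ρ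
    have hcont : ContinuousOn (fun x => ‖gradF t x‖) (Metric.sphere p ρ) := by
      refine ContinuousOn.norm ?_
      exact hgc.comp (f := fun x => (t, x)) (by fun_prop) (fun x _ => ⟨ht, mem_univ _⟩)
    rcases (Metric.sphere p ρ).eq_empty_or_nonempty with h | h
    · refine ⟨1, one_pos, fun x hx => ?_⟩
      have : x ∈ Metric.sphere p ρ := by simpa [dist_eq_norm] using hx
      rw [h] at this
      exact absurd this (notMem_empty x)
    · obtain ⟨x₀, hx₀, hmin⟩ := hcomp.exists_isMinOn h hcont
      refine ⟨‖gradF t x₀‖, norm_pos_iff.2 (hcrit x₀ (by simpa [dist_eq_norm] using hx₀)), ?_⟩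
      intro x hx
      exact hmin (by simpa [dist_eq_norm] using hx : x ∈ Metric.sphere p ρ)
  -- uniform continuity
  have huc : UniformContinuousOn (fun q : ℝ × X => gradF q.1 q.2)
      (Icc 0 T ×ˢ Metric.closedBall p (2 * ρ)) :=
    (isCompact_Icc.prod (isCompact_closedBall p (2 * ρ))).uniformContinuousOn_of_continuous
      (hgc.mono (prod_mono le_rfl (subset_univ _)))
  obtain ⟨δ, hδ, hδu⟩ := Metric.uniformContinuousOn_iff.1 huc (κ / 2) (by positivity)
  obtain ⟨w, hw, hw1, hw2, hw3⟩ : ∃ w > (0 : ℝ), w < δ ∧ w < ρ / 2 ∧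
      w * (3 * ‖A‖ + ‖B‖) < κ / 12 := by
    have hK : 0 < 3 * ‖A‖ + ‖B‖ + 1 := by positivity
    refine ⟨min (min (δ / 2) (ρ / 4)) (κ / 24 / (3 * ‖A‖ + ‖B‖ + 1)), by positivity, ?_, ?_, ?_⟩
    · exact ((min_le_left _ _).trans (min_le_left _ _)).trans_lt (by linarith)
    · exact ((min_le_left _ _).trans (min_le_right _ _)).trans_lt (by linarith)
    · have h1 : min (min (δ / 2) (ρ / 4)) (κ / 24 / (3 * ‖A‖ + ‖B‖ + 1)) * (3 * ‖A‖ + ‖B‖)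
          ≤ κ / 24 / (3 * ‖A‖ + ‖B‖ + 1) * (3 * ‖A‖ + ‖B‖ + 1) := by
        refine mul_le_mul (min_le_right _ _) (by linarith) (by positivity) (by positivity)
      rw [div_mul_cancel₀ _ hK.ne'] at h1
      linarith
  refine ⟨β * w ^ 2, by positivity, δ, hδ, ?_⟩
  intro ε hε a b ha hab hb hta htb v v' v'' D D' hv hv' hode hD hDv hρab hρa
  by_contra hcon
  push Not at hcon
  have hmonoD : ∀ x y, 0 ≤ x → x ≤ y → y ≤ T → D x ≤ D y := by
    intro x y h1 h2 h3
    have hsub : Icc x y ⊆ Icc 0 T := Icc_subset_Icc h1 h3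
    have := le_of_hasDerivWithinAt_nonpos (f := fun r => - D r) (f' := fun r => - D' r) h2
      (fun r hr => ((hD r (hsub hr)).mono hsub).neg) (fun r hr => by
        have h1 := hDv r (hsub hr)
        have h2 : 0 ≤ ε * β * ‖v' r‖ ^ 2 := by positivity
        linarith)
    linarith
  have hcont : ContinuousOn (fun x => ‖v x - p‖) (uIcc a b) := by
    rw [uIcc_of_le hab]
    intro x hx
    have : ContinuousWithinAt v (Icc a b) x :=
      (hv x ⟨ha.trans hx.1, hx.2.trans hb⟩).continuousWithinAt.mono (Icc_subset_Icc ha hb)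
    exact (this.sub continuousWithinAt_const).norm
  obtain ⟨z, hz, hzρ⟩ := intermediate_value_uIcc hcont hρab
  rw [uIcc_of_le hab] at hz
  simp only at hzρ
  have hmove : ∀ r, a ≤ r → r ≤ z → z - r ≤ ε → ‖v z - v r‖ ≤ w := by
    intro r h1 h2 h3
    have hsub : Icc r z ⊆ Icc 0 T := Icc_subset_Icc (ha.trans h1) (hz.2.trans hb)
    refine small_move h2 hε hβ hw h3 (fun x hx => (hv x (hsub hx)).mono hsub)
      (fun x hx => (hD x (hsub hx)).mono hsub) (fun x hx => hDv x (hsub hx)) ?_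
    have h4 := hmonoD a r ha h1 (by linarith [hz.2])
    have h5 := hmonoD z b (by linarith [hz.1]) hz.2 hb
    linarith
  have haz : a ≤ z - ε := by
    by_contra h
    push Not at h
    have h1 := hmove a le_rfl hz.1 (by linarith)
    have h2 : |‖v a - p‖ - ρ| ≤ ‖v z - v a‖ := by
      rw [← hzρ]
      refine (abs_norm_sub_norm_le _ _).trans (le_of_eq ?_)
      rw [norm_sub_rev]
      congr 1
      abel
    linarith
  set e := gradF t (v z) with he
  have hκe : κ ≤ ‖e‖ := hκs _ hzρ
  have hsub : Icc (z - ε) z ⊆ Icc 0 T := Icc_subset_Icc (ha.trans haz) (hz.2.trans hb)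
  have hmv : ∀ x ∈ Icc (z - ε) z, ‖v x - v z‖ ≤ w := fun x hx => by
    rw [norm_sub_rev]
    exact hmove x (haz.trans hx.1) hx.2 (by linarith [hx.1])
  have key := force_move A B (a := z - ε) (c := z) (w := w) (m := ‖e‖ ^ 2 / 2) (e := e) hε
    (by ring) (fun x hx => (hv x (hsub hx)).mono hsub) (fun x hx => (hv' x (hsub hx)).mono hsub)
    hmv
    (fun x hx => by
      have h0 := hode x (hsub hx)
      have h1 : ⟪ε ^ 2 • A (v'' x) + ε • B (v' x) + gradF x (v x), e⟫ = 0 := by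
        rw [h0, inner_zero_left]
      simp only [inner_add_left, real_inner_smul_left] at h1
      have h2 : ‖gradF x (v x) - e‖ ≤ κ / 2 := by
        have hz2 : v z ∈ Metric.closedBall p (2 * ρ) := by
          rw [mem_closedBall_iff_norm]; linarith
        have hx2 : v x ∈ Metric.closedBall p (2 * ρ) := by
          rw [mem_closedBall_iff_norm]
          have h3 := hmv x hx
          have h4 : v x - p = (v x - v z) + (v z - p) := by abel
          rw [h4]
          refine (norm_add_le _ _).trans ?_
          linarith
        have := hδu (x, v x) ⟨hsub hx, hx2⟩ (t, v z) ⟨ht, hz2⟩ (by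
          rw [Prod.dist_eq, max_lt_iff]
          constructor
          · simp only
            rw [Real.dist_eq, abs_lt]
            constructor <;> linarith [hx.1, hx.2, hz.2]
          · simp only
            rw [dist_eq_norm]
            exact (hmv x hx).trans_lt hw1)
        rw [dist_eq_norm] at this
        exact this.le
      have h3 : ⟪gradF x (v x), e⟫ = ‖e‖ ^ 2 + ⟪gradF x (v x) - e, e⟫ := by
        rw [inner_sub_left, real_inner_self_eq_norm_sq]
        ring
      have h4 := (abs_le.1 (abs_real_inner_le_norm (gradF x (v x) - e) e)).1
      have h5 : ‖gradF x (v x) - e‖ * ‖e‖ ≤ ‖e‖ / 2 * ‖e‖ := by gcongr; linarith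
      nlinarith)
  have hepos : 0 < ‖e‖ := by linarith
  have : ‖e‖ * (w * (3 * ‖A‖ + ‖B‖)) < ‖e‖ * (κ / 12) := by gcongr
  nlinarith

end cross

section prelim
variable {X : Type*} [NormedAddCommGroup X] [InnerProductSpace ℝ X]

lemma exists_coercive [FiniteDimensional ℝ X] (B : X →L[ℝ] X)
    (hBpos : ∀ x : X, x ≠ 0 → 0 < ⟪x, B x⟫) :
    ∃ β > (0 : ℝ), ∀ x : X, β * ‖x‖ ^ 2 ≤ ⟪B x, x⟫ := by
  rcases (Metric.sphere (0 : X) 1).eq_empty_or_nonempty with h | h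
  · refine ⟨1, one_pos, fun x => ?_⟩
    by_cases hx : x = 0
    · simp [hx]
    · have : (‖x‖⁻¹ • x) ∈ Metric.sphere (0 : X) 1 := by
        simp [norm_smul, hx]
      rw [h] at this
      exact absurd this (notMem_empty _)
  · obtain ⟨x₀, hx₀, hmin⟩ := (isCompact_sphere (0 : X) 1).exists_isMinOn h
      (f := fun x => ⟪B x, x⟫) (by fun_prop)
    have hx₀' : x₀ ≠ 0 := by
      rintro rfl
      simp at hx₀
    refine ⟨⟪B x₀, x₀⟫, by rw [real_inner_comm]; exact hBpos x₀ hx₀', fun x => ?_⟩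
    by_cases hx : x = 0
    · simp [hx]
    · have h1 : (‖x‖⁻¹ • x) ∈ Metric.sphere (0 : X) 1 := by
        simp [norm_smul, hx]
      have h2 : ⟪B x₀, x₀⟫ ≤ ⟪B (‖x‖⁻¹ • x), ‖x‖⁻¹ • x⟫ := hmin h1
      rw [map_smul, real_inner_smul_left, real_inner_smul_right] at h2
      have hn : 0 < ‖x‖ := norm_pos_iff.2 hx
      calc ⟪B x₀, x₀⟫ * ‖x‖ ^ 2 ≤ (‖x‖⁻¹ * (‖x‖⁻¹ * ⟪B x, x⟫)) * ‖x‖ ^ 2 := by gcongr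
        _ = ⟪B x, x⟫ := by field_simp

lemma F_chain [CompleteSpace X] {T : ℝ} (hT : 0 < T) {F dtF : ℝ → X → ℝ} {gradF : ℝ → X → X}
    (hF0 : ContDiffOn ℝ 1 (fun p : ℝ × X => F p.1 p.2) (Set.Icc 0 T ×ˢ Set.univ))
    (hgradF : ∀ t ∈ Set.Icc 0 T, ∀ x : X, HasGradientAt (F t) (gradF t x) x)
    (hdtF : ∀ x : X, ∀ t ∈ Set.Icc 0 T,
      HasDerivWithinAt (fun τ => F τ x) (dtF t x) (Set.Icc 0 T) t) :
    ContinuousOn (fun p : ℝ × X => dtF p.1 p.2) (Icc 0 T ×ˢ univ) ∧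
    ∀ (v : ℝ → X) (v' : X), ∀ t ∈ Icc 0 T, HasDerivWithinAt v v' (Icc 0 T) t →
      HasDerivWithinAt (fun r => F r (v r)) (dtF t (v t) + ⟪gradF t (v t), v'⟫) (Icc 0 T) t := by
  set f := fun p : ℝ × X => F p.1 p.2 with hf
  set S : Set (ℝ × X) := Icc 0 T ×ˢ univ with hS
  have hu : UniqueDiffOn ℝ S := (uniqueDiffOn_Icc hT).prod uniqueDiffOn_univ
  have hd : ∀ t ∈ Icc 0 T, ∀ x, HasFDerivWithinAt f (fderivWithin ℝ f S (t, x)) S (t, x) := by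
    intro t ht x
    exact ((hF0.differentiableOn one_ne_zero) (t, x) ⟨ht, mem_univ _⟩).hasFDerivWithinAt
  have h1 : ∀ t ∈ Icc 0 T, ∀ x, fderivWithin ℝ f S (t, x) (1, 0) = dtF t x := by
    intro t ht x
    have e := (hd t ht x).comp_hasDerivWithinAt t (f := fun τ : ℝ => (τ, x)) (s := Icc 0 T)
      ((hasDerivWithinAt_id t _).prodMk (hasDerivWithinAt_const t _ x)) (fun τ hτ => ⟨hτ, mem_univ _⟩)
    exact (uniqueDiffOn_Icc hT t ht).eq_deriv _ e (hdtF x t ht)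
  have h2 : ∀ t ∈ Icc 0 T, ∀ x v, fderivWithin ℝ f S (t, x) (0, v) = ⟪gradF t x, v⟫ := by
    intro t ht x v
    have e := (hd t ht x).comp (f := fun y : X => (t, y)) (s := univ) x
      ((hasFDerivWithinAt_const t x _).prodMk (hasFDerivWithinAt_id x _)) (fun τ hτ => ⟨ht, mem_univ _⟩)
    have e2 := (hasFDerivWithinAt_univ.1 e).unique (hgradF t ht x).hasFDerivAt
    have := congrArg (fun L : X →L[ℝ] ℝ => L v) e2
    simpa using this
  constructor
  · have hc : ContinuousOn (fun q => fderivWithin ℝ f S q) S := hF0.continuousOn_fderivWithin hu le_rfl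
    have hc2 : ContinuousOn (fun q => fderivWithin ℝ f S q (1, 0)) S := hc.clm_apply continuousOn_const
    refine hc2.congr ?_
    rintro ⟨t, x⟩ hq
    exact (h1 t hq.1 x).symm
  · intro v v' t ht hv
    have e := (hd t ht (v t)).comp_hasDerivWithinAt t (f := fun τ : ℝ => (τ, v τ)) (s := Icc 0 T)
      ((hasDerivWithinAt_id t _).prodMk hv) (fun τ hτ => ⟨hτ, mem_univ _⟩)
    refine e.congr_deriv ?_
    rw [← h1 t ht, ← h2 t ht, ← map_add]
    simp

lemma grad_cont {T : ℝ} {gradF : ℝ → X → X} {hessF : ℝ → X → X →L[ℝ] X}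
    (hF3' : ∀ x₀ : X, ∃ r > (0 : ℝ), ∃ L : ℝ, 0 ≤ L ∧ ∀ x ∈ Metric.ball x₀ r,
      ∀ s ∈ Set.Icc 0 T, ∀ t ∈ Set.Icc 0 T, ‖gradF s x - gradF t x‖ ≤ L * |s - t|)
    (hhessF : ∀ t ∈ Set.Icc 0 T, ∀ x : X, HasFDerivAt (gradF t) (hessF t x) x) :
    ContinuousOn (fun p : ℝ × X => gradF p.1 p.2) (Icc 0 T ×ˢ univ) := by
  rintro ⟨t, x⟩ ⟨ht, -⟩
  obtain ⟨r, hr, L, hL, hb⟩ := hF3' x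
  have ht : t ∈ Icc 0 T := ht
  have hfst : Tendsto (fun q : ℝ × X => q.1) (𝓝[Icc 0 T ×ˢ univ] (t, x)) (𝓝 t) :=
    (continuous_fst.tendsto (t, x)).mono_left nhdsWithin_le_nhds
  have hsnd : Tendsto (fun q : ℝ × X => q.2) (𝓝[Icc 0 T ×ˢ univ] (t, x)) (𝓝 x) :=
    (continuous_snd.tendsto (t, x)).mono_left nhdsWithin_le_nhds
  have h1 : Tendsto (fun q : ℝ × X => gradF t q.2) (𝓝[Icc 0 T ×ˢ univ] (t, x)) (𝓝 (gradF t x)) :=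
    (hhessF t ht x).continuousAt.tendsto.comp hsnd
  have h2 : Tendsto (fun q : ℝ × X => gradF q.1 q.2 - gradF t q.2) (𝓝[Icc 0 T ×ˢ univ] (t, x)) (𝓝 0) := by
    have h3 : Tendsto (fun q : ℝ × X => L * |q.1 - t|) (𝓝[Icc 0 T ×ˢ univ] (t, x)) (𝓝 0) := by
      have : Tendsto (fun q : ℝ × X => L * |q.1 - t|) (𝓝[Icc 0 T ×ˢ univ] (t, x)) (𝓝 (L * |t - t|)) :=
        ((hfst.sub_const t).abs).const_mul L
      simpa using this
    refine squeeze_zero_norm' ?_ h3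
    filter_upwards [self_mem_nhdsWithin, hsnd (Metric.ball_mem_nhds x hr)] with q hq hq2
    exact hb q.2 hq2 q.1 hq.1 t ht
  have := h2.add h1
  simpa [ContinuousWithinAt] using this

lemma fatou_good {T C : ℝ} (hT : 0 < T) {k : ℝ → ℝ → ℝ}
    (hk : ∀ ε > (0 : ℝ), ContinuousOn (k ε) (Icc 0 T))
    (hk0 : ∀ ε > (0 : ℝ), ∀ t ∈ Icc 0 T, 0 ≤ k ε t)
    (hint : ∀ᶠ ε in 𝓝[>] (0 : ℝ), ∫ t in (0 : ℝ)..T, k ε t ≤ C * ε) :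
    ∀ a b, 0 ≤ a → a < b → b ≤ T → ∃ t ∈ Ioo a b, ∀ η > (0 : ℝ), ∃ᶠ ε in 𝓝[>] (0 : ℝ), k ε t < η := by
  set ν := (volume : Measure ℝ).restrict (Ioc 0 T) with hν
  let ι : ℕ → ℝ := fun n => 1 / ((n : ℝ) + 1)
  have hι : ∀ n, 0 < ι n := fun n => by positivity
  have hιt : Tendsto ι atTop (𝓝[>] 0) :=
    tendsto_nhdsWithin_iff.2 ⟨tendsto_one_div_add_atTop_nhds_zero_nat, Eventually.of_forall hι⟩
  let f : ℕ → ℝ → ENNReal := fun n t => ENNReal.ofReal (k (ι n) t)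
  have hmeas : ∀ n, AEMeasurable (f n) ν := by
    intro n
    exact (((hk _ (hι n)).mono Ioc_subset_Icc_self).aemeasurable measurableSet_Ioc).ennreal_ofReal
  have hle := lintegral_liminf_le' (μ := ν) (u := atTop) hmeas
  have hlim : Tendsto (fun n => ∫⁻ t, f n t ∂ν) atTop (𝓝 0) := by
    have hC : Tendsto (fun n => ENNReal.ofReal (C * ι n)) atTop (𝓝 0) := by
      have h0 : Tendsto (fun n => C * ι n) atTop (𝓝 (C * 0)) :=
        (hιt.mono_right nhdsWithin_le_nhds).const_mul C
      have := ENNReal.tendsto_ofReal h0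
      simpa using this
    refine tendsto_of_tendsto_of_tendsto_of_le_of_le' tendsto_const_nhds hC
      (Eventually.of_forall fun _ => zero_le) ?_
    filter_upwards [hιt.eventually hint] with n h1
    have hi : Integrable (k (ι n)) ν :=
      ((hk _ (hι n)).integrableOn_Icc).mono_set Ioc_subset_Icc_self
    have : ∫⁻ t, f n t ∂ν = ENNReal.ofReal (∫ t, k (ι n) t ∂ν) := by
      rw [ofReal_integral_eq_lintegral_ofReal hi]
      filter_upwards [ae_restrict_mem measurableSet_Ioc] with t ht
      exact hk0 _ (hι n) t (Ioc_subset_Icc_self ht)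
    rw [this]
    apply ENNReal.ofReal_le_ofReal
    rwa [intervalIntegral.integral_of_le hT.le] at h1
  rw [hlim.liminf_eq] at hle
  have hmeas2 : AEMeasurable (fun t => liminf (fun n => f n t) atTop) ν := by
    refine ⟨fun t => liminf (fun n => (hmeas n).mk (f n) t) atTop,
      Measurable.liminf fun n => (hmeas n).measurable_mk, ?_⟩
    filter_upwards [ae_all_iff.2 fun n => (hmeas n).ae_eq_mk] with t ht
    simp only [ht]
  have hae := (lintegral_eq_zero_iff' hmeas2).1 (le_antisymm hle zero_le)
  intro a b ha hab hb
  have hae2 : ∀ᵐ t ∂(volume.restrict (Ioo a b)), liminf (fun n => f n t) atTop = 0 := by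
    refine ae_mono (Measure.restrict_mono ?_ le_rfl) hae
    intro x hx
    exact ⟨ha.trans_lt hx.1, hx.2.le.trans hb⟩
  rw [ae_restrict_iff' measurableSet_Ioo] at hae2
  have hex : ∃ t, t ∈ Ioo a b ∧ liminf (fun n => f n t) atTop = 0 := by
    by_contra hcon
    push Not at hcon
    have h0 : volume (Ioo a b) = 0 := by
      refine measure_mono_null ?_ hae2
      intro t ht h
      exact hcon t ht (h ht)
    rw [Real.volume_Ioo, ENNReal.ofReal_eq_zero] at h0
    linarith
  obtain ⟨t, ht, hl⟩ := hex
  refine ⟨t, ht, fun η hη hcon => ?_⟩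
  have h1 : ENNReal.ofReal η ≤ liminf (fun n => f n t) atTop := by
    refine le_liminf_of_le (by isBoundedDefault) ?_
    filter_upwards [hιt.eventually hcon] with n h1
    exact ENNReal.ofReal_le_ofReal (not_lt.1 h1)
  rw [hl] at h1
  have := ENNReal.ofReal_pos.2 hη
  exact absurd h1 (not_le.2 this)

end prelim

lemma gronwall_fwd {f f' : ℝ → ℝ} {a b C : ℝ} (hab : a ≤ b)
    (h : ∀ x ∈ Icc a b, HasDerivWithinAt f (f' x) (Icc a b) x)
    (hn : ∀ x ∈ Icc a b, f' x ≤ C * f x) : f b ≤ Real.exp (C * (b - a)) * f a := by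
  have key := le_of_hasDerivWithinAt_nonpos (f := fun x => f x * Real.exp (-C * x))
    (f' := fun x => f' x * Real.exp (-C * x) + f x * (Real.exp (-C * x) * -C)) hab
    (fun x hx => by
      have h1 : HasDerivAt (fun x => Real.exp (-C * x)) (Real.exp (-C * x) * -C) x := by
        have := ((hasDerivAt_id x).const_mul (-C)).exp
        simpa using this
      exact (h x hx).mul h1.hasDerivWithinAt)
    (fun x hx => by
      have h1 := hn x hx
      have h2 := Real.exp_pos (-C * x)
      nlinarith)
  have e1 : Real.exp (C * (b - a)) = Real.exp (C * b) * Real.exp (-C * a) := by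
    rw [← Real.exp_add]; ring_nf
  have e2 : f b = Real.exp (C * b) * (f b * Real.exp (-C * b)) := by
    have : Real.exp (C * b) * Real.exp (-C * b) = 1 := by
      rw [← Real.exp_add]; simp
    linear_combination (-f b) * this
  rw [e1, e2]
  calc Real.exp (C * b) * (f b * Real.exp (-C * b)) ≤ Real.exp (C * b) * (f a * Real.exp (-C * a)) := by
        gcongr
    _ = _ := by ring

section energy
variable {X : Type*} [NormedAddCommGroup X] [InnerProductSpace ℝ X]

/-- Energy identity in differential form, for a single solution. -/
lemma energy_deriv (A B : X →L[ℝ] X) (hAsymm : ∀ x y : X, ⟪A x, y⟫ = ⟪x, A y⟫)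
    {T : ℝ} {F dtF : ℝ → X → ℝ} {gradF : ℝ → X → X}
    (hch : ∀ (v : ℝ → X) (v' : X), ∀ t ∈ Icc 0 T, HasDerivWithinAt v v' (Icc 0 T) t →
      HasDerivWithinAt (fun r => F r (v r)) (dtF t (v t) + ⟪gradF t (v t), v'⟫) (Icc 0 T) t)
    {ε : ℝ} {v v' v'' : ℝ → X}
    (hv : ∀ x ∈ Icc 0 T, HasDerivWithinAt v (v' x) (Icc 0 T) x)
    (hv' : ∀ x ∈ Icc 0 T, HasDerivWithinAt v' (v'' x) (Icc 0 T) x)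
    (hode : ∀ x ∈ Icc 0 T, ε ^ 2 • A (v'' x) + ε • B (v' x) + gradF x (v x) = 0) :
    ∀ t ∈ Icc 0 T, HasDerivWithinAt (fun r => F r (v r) + ε ^ 2 / 2 * ⟪A (v' r), v' r⟫)
      (dtF t (v t) - ε * ⟪B (v' t), v' t⟫) (Icc 0 T) t := by
  intro t ht
  have h1 := hch v (v' t) t ht (hv t ht)
  have h2 : HasDerivWithinAt (fun r => A (v' r)) (A (v'' t)) (Icc 0 T) t :=
    A.hasFDerivAt.comp_hasDerivWithinAt t (hv' t ht)
  have h3 := (h2.inner ℝ (hv' t ht)).const_mul (ε ^ 2 / 2)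
  refine (h1.add h3).congr_deriv ?_
  have h4 : ⟪ε ^ 2 • A (v'' t) + ε • B (v' t) + gradF t (v t), v' t⟫ = 0 := by
    rw [hode t ht, inner_zero_left]
  simp only [inner_add_left, real_inner_smul_left] at h4
  have h5 : ⟪A (v' t), v'' t⟫ = ⟪A (v'' t), v' t⟫ := by
    rw [hAsymm, real_inner_comm]
  rw [h5]
  linarith

lemma primitive_deriv {T : ℝ} {g : ℝ → ℝ} (hg : ContinuousOn g (Icc 0 T)) :
    ∀ t ∈ Icc 0 T, HasDerivWithinAt (fun r => ∫ x in (0 : ℝ)..r, g x) (g t) (Icc 0 T) t := by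
  intro t ht
  have : Fact (t ∈ Icc 0 T) := ⟨ht⟩
  refine intervalIntegral.integral_hasDerivWithinAt_right ?_ (t := Icc 0 T) ?_ (hg t ht)
  · refine ContinuousOn.intervalIntegrable ?_
    rw [uIcc_of_le ht.1]
    exact hg.mono (Icc_subset_Icc_right ht.2)
  · exact hg.stronglyMeasurableAtFilter_nhdsWithin measurableSet_Icc t

end energy



/-- Energy balance: there is a positive atomic measure `μ`, supported exactly on the jump set
`J` of the limit function `u`, realizing the energy balance on every interval `[s,t] ⊆ [0,T]`. -/
theorem energy_balance
    {X : Type*} [NormedAddCommGroup X] [InnerProductSpace ℝ X] [FiniteDimensional ℝ X]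
    (A B : X →L[ℝ] X)
    (hAsymm : ∀ x y : X, ⟪A x, y⟫ = ⟪x, A y⟫)
    (hApos : ∀ x : X, x ≠ 0 → 0 < ⟪x, A x⟫)
    (hBsymm : ∀ x y : X, ⟪B x, y⟫ = ⟪x, B y⟫)
    (hBpos : ∀ x : X, x ≠ 0 → 0 < ⟪x, B x⟫)
    (T : ℝ) (hT : 0 < T)
    (F dtF : ℝ → X → ℝ) (gradF : ℝ → X → X)
    -- (F0)
    (hF0 : ContDiffOn ℝ 1 (fun p : ℝ × X => F p.1 p.2) (Set.Icc 0 T ×ˢ Set.univ))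
    (hgradF : ∀ t ∈ Set.Icc 0 T, ∀ x : X, HasGradientAt (F t) (gradF t x) x)
    (hdtF : ∀ x : X, ∀ t ∈ Set.Icc 0 T,
      HasDerivWithinAt (fun τ => F τ x) (dtF t x) (Set.Icc 0 T) t)
    -- (F1)
    (hF1 : ∀ ρ > (0 : ℝ), Bornology.IsBounded {x : X | ∀ t ∈ Set.Icc 0 T, |F t x| ≤ ρ})
    -- (F2)
    (C₁ C₂ : ℝ) (hC₁ : 0 < C₁) (hC₂ : 0 < C₂)
    (hF2 : ∀ t ∈ Set.Icc 0 T, ∀ x : X, |dtF t x| ≤ C₁ * F t x + C₂)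
    -- (F3')
    (hF3' : ∀ x₀ : X, ∃ r > (0 : ℝ), ∃ L : ℝ, 0 ≤ L ∧ ∀ x ∈ Metric.ball x₀ r,
      ∀ s ∈ Set.Icc 0 T, ∀ t ∈ Set.Icc 0 T, ‖gradF s x - gradF t x‖ ≤ L * |s - t|)
    -- (F4)
    (hessF : ℝ → X → X →L[ℝ] X)
    (hF4 : ∀ t ∈ Set.Icc 0 T, ContDiff ℝ 2 (F t))
    (hhessF : ∀ t ∈ Set.Icc 0 T, ∀ x : X, HasFDerivAt (gradF t) (hessF t x) x)
    (hhessFc : ContinuousOn (fun p : ℝ × X => hessF p.1 p.2) (Set.Icc 0 T ×ˢ Set.univ))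
    -- (F5)
    (hF5 : ∀ t ∈ Set.Icc 0 T, ∀ x : X, gradF t x = 0 →
      ∃ r > (0 : ℝ), ∀ y : X, gradF t y = 0 → y ∈ Metric.ball x r → y = x)
    -- (F6)
    (hF6 : ∀ t ∈ Set.Icc 0 T, ∀ x : X, gradF t x = 0 →
      0 ≤ Filter.liminf (fun v : X => (((F t v - F t x) / ‖gradF t v‖ : ℝ) : EReal)) (𝓝[≠] x))
    -- the family of solutions u_ε, with derivatives u'_ε, u''_ε
    (u u' u'' : ℝ → ℝ → X)
    (hu' : ∀ ε > (0 : ℝ), ∀ t ∈ Set.Icc 0 T, HasDerivWithinAt (u ε) (u' ε t) (Set.Icc 0 T) t)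
    (hu'' : ∀ ε > (0 : ℝ), ∀ t ∈ Set.Icc 0 T, HasDerivWithinAt (u' ε) (u'' ε t) (Set.Icc 0 T) t)
    (hu''c : ∀ ε > (0 : ℝ), ContinuousOn (u'' ε) (Set.Icc 0 T))
    (hode : ∀ ε > (0 : ℝ), ∀ t ∈ Set.Icc 0 T,
      ε ^ 2 • A (u'' ε t) + ε • B (u' ε t) + gradF t (u ε t) = 0)
    -- initial data: u_ε(0) uniformly bounded and ε u̇_ε(0) → 0
    (R : ℝ) (hR : 0 < R)
    (hinit : ∀ ε > (0 : ℝ), ‖u ε 0‖ ≤ R)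
    (hinit' : Filter.Tendsto (fun ε : ℝ => ε • u' ε 0) (𝓝[>] 0) (𝓝 0))
    -- pointwise convergence of u_ε to the regulated function u₀
    (u₀ up um : ℝ → X)
    (hconv : ∀ t ∈ Set.Icc 0 T, Filter.Tendsto (fun ε : ℝ => u ε t) (𝓝[>] 0) (𝓝 (u₀ t)))
    (hup : ∀ s ∈ Set.Ico 0 T, Filter.Tendsto u₀ (𝓝[>] s) (𝓝 (up s)))
    (hum : ∀ s ∈ Set.Ioc 0 T, Filter.Tendsto u₀ (𝓝[<] s) (𝓝 (um s)))
    (hupT : up T = u₀ T) (hum0 : um 0 = u₀ 0)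
    -- stability of the one-sided limits on (0,T]
    (hstab : ∀ t ∈ Set.Ioc 0 T, gradF t (up t) = 0 ∧ gradF t (um t) = 0)
    -- the jump set of u₀
    (J : Set ℝ)
    (hJ : J = {t ∈ Set.Icc 0 T | up t ≠ um t ∨ (u₀ t ≠ up t ∧ u₀ t ≠ um t)}) :
    ∃ μ : MeasureTheory.Measure ℝ,
      -- μ is atomic, concentrated on J
      (∀ s : Set ℝ, MeasurableSet s → μ s = ∑' t : ↥(s ∩ J), μ {(t : ℝ)}) ∧
      -- the atoms of μ are exactly the points of J
      (∀ t : ℝ, μ {t} ≠ 0 ↔ t ∈ J) ∧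
      -- energy balance
      (∀ s t : ℝ, 0 ≤ s → s ≤ t → t ≤ T →
        F t (up t) + (μ (Set.Icc s t)).toReal
          = F s (um s) + ∫ r in s..t, dtF r (u₀ r)) := by
  classical
  obtain ⟨β, hβ, hβB⟩ := exists_coercive B hBpos
  obtain ⟨hdc, hch⟩ := F_chain hT hF0 hgradF hdtF
  have hgc := grad_cont hF3' hhessF
  have h0T : (0 : ℝ) ∈ Icc 0 T := ⟨le_rfl, hT.le⟩
  -- the energy and the dissipation
  obtain ⟨kin, hkin⟩ : ∃ kin : ℝ → ℝ → ℝ, kin = fun ε t => ε ^ 2 / 2 * ⟪A (u' ε t), u' ε t⟫ := ⟨_, rfl⟩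
  obtain ⟨D, hDdef⟩ : ∃ D : ℝ → ℝ → ℝ, D = fun ε t =>
    (∫ r in (0 : ℝ)..t, dtF r (u ε r)) - (F t (u ε t) + kin ε t) := ⟨_, rfl⟩
  have huc : ∀ ε > (0 : ℝ), ContinuousOn (u ε) (Icc 0 T) :=
    fun ε hε t ht => (hu' ε hε t ht).continuousWithinAt
  have hu'c : ∀ ε > (0 : ℝ), ContinuousOn (u' ε) (Icc 0 T) :=
    fun ε hε t ht => (hu'' ε hε t ht).continuousWithinAt
  have hkin0 : ∀ ε t, 0 ≤ kin ε t := by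
    intro ε t
    have : 0 ≤ ⟪A (u' ε t), u' ε t⟫ := by
      by_cases h : u' ε t = 0
      · simp [h]
      · rw [real_inner_comm]; exact (hApos _ h).le
    rw [hkin]; positivity
  have hdtc : ∀ ε > (0 : ℝ), ContinuousOn (fun r => dtF r (u ε r)) (Icc 0 T) := by
    intro ε hε
    exact hdc.comp (f := fun r => (r, u ε r)) (continuousOn_id.prodMk (huc ε hε))
      (fun r hr => ⟨hr, mem_univ _⟩)
  have hE : ∀ ε > (0 : ℝ), ∀ t ∈ Icc 0 T, HasDerivWithinAt (fun r => F r (u ε r) + kin ε r)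
      (dtF t (u ε t) - ε * ⟪B (u' ε t), u' ε t⟫) (Icc 0 T) t := by
    intro ε hε
    rw [hkin]
    exact energy_deriv A B hAsymm hch (hu' ε hε) (hu'' ε hε) (hode ε hε)
  have hD : ∀ ε > (0 : ℝ), ∀ t ∈ Icc 0 T,
      HasDerivWithinAt (D ε) (ε * ⟪B (u' ε t), u' ε t⟫) (Icc 0 T) t := by
    intro ε hε t ht
    rw [hDdef]
    refine ((primitive_deriv (hdtc ε hε) t ht).sub (hE ε hε t ht)).congr_deriv ?_
    ring
  have hDv : ∀ ε > (0 : ℝ), ∀ t ∈ Icc 0 T, ε * β * ‖u' ε t‖ ^ 2 ≤ ε * ⟪B (u' ε t), u' ε t⟫ := by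
    intro ε hε t ht
    rw [mul_assoc]
    exact mul_le_mul_of_nonneg_left (hβB _) hε.le
  have hDnn : ∀ ε > (0 : ℝ), ∀ t ∈ Icc 0 T, 0 ≤ ε * ⟪B (u' ε t), u' ε t⟫ := by
    intro ε hε t ht
    exact le_trans (by positivity) (hDv ε hε t ht)
  have hDmono : ∀ ε > (0 : ℝ), ∀ x y, 0 ≤ x → x ≤ y → y ≤ T → D ε x ≤ D ε y := by
    intro ε hε x y h1 h2 h3
    have hsub : Icc x y ⊆ Icc 0 T := Icc_subset_Icc h1 h3
    have := le_of_hasDerivWithinAt_nonpos (f := fun r => - D ε r)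
      (f' := fun t => - (ε * ⟪B (u' ε t), u' ε t⟫)) h2
      (fun r hr => ((hD ε hε r (hsub hr)).mono hsub).neg)
      (fun r hr => by have := hDnn ε hε r (hsub hr); linarith)
    linarith
  have hDdiff : ∀ ε > (0 : ℝ), ∀ a b, 0 ≤ a → a ≤ b → b ≤ T → D ε b - D ε a
      = (∫ r in a..b, dtF r (u ε r)) + (F a (u ε a) + kin ε a) - (F b (u ε b) + kin ε b) := by
    intro ε hε a b h1 h2 h3
    have hi : ∀ y ∈ Icc 0 T, IntervalIntegrable (fun r => dtF r (u ε r)) volume 0 y := by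
      intro y hy
      refine ContinuousOn.intervalIntegrable ?_
      rw [uIcc_of_le hy.1]
      exact (hdtc ε hε).mono (Icc_subset_Icc_right hy.2)
    have := intervalIntegral.integral_interval_sub_left (hi b ⟨by linarith, h3⟩) (hi a ⟨h1, by linarith⟩)
    rw [hDdef]
    simp only
    linarith
  -- a priori bounds
  have hFlow : ∀ t ∈ Icc 0 T, ∀ x, 0 ≤ F t x + C₂ / C₁ := by
    intro t ht x
    have h1 := (abs_nonneg _).trans (hF2 t ht x)
    have e : C₁ * (F t x + C₂ / C₁) = C₁ * F t x + C₂ := by field_simp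
    rw [← e] at h1
    exact nonneg_of_mul_nonneg_right h1 hC₁
  have hkinlim : Tendsto (fun ε => kin ε 0) (𝓝[>] 0) (𝓝 0) := by
    have hcq : Continuous (fun x : X => 1 / 2 * ⟪A x, x⟫) := by fun_prop
    have h1 := (hcq.tendsto 0).comp hinit'
    have e : (fun ε => kin ε 0) = (fun x : X => 1 / 2 * ⟪A x, x⟫) ∘ (fun ε : ℝ => ε • u' ε 0) := by
      funext ε
      simp only [hkin, Function.comp, map_smul, real_inner_smul_left, real_inner_smul_right]
      ring
    rw [e]
    simpa using h1
  obtain ⟨K₁, hK₁⟩ : ∃ K₁, ∀ x : X, ‖x‖ ≤ R → F 0 x ≤ K₁ := by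
    have hc0 : Continuous (F 0) := (hF4 0 h0T).continuous
    obtain ⟨K₁, h⟩ := (isCompact_closedBall (0 : X) R).bddAbove_image hc0.continuousOn
    exact ⟨K₁, fun x hx => h ⟨x, by simpa using hx, rfl⟩⟩
  obtain ⟨K, hK⟩ : ∃ K, ∀ᶠ ε in 𝓝[>] (0 : ℝ), ∀ t ∈ Icc 0 T, F t (u ε t) ≤ K ∧ F 0 (u ε 0) + kin ε 0 ≤ K := by
    refine ⟨max (K₁ + 1) (Real.exp (C₁ * T) * (K₁ + 1 + C₂ / C₁) - C₂ / C₁), ?_⟩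
    filter_upwards [self_mem_nhdsWithin, hkinlim.eventually (gt_mem_nhds one_pos)] with ε hε hk t ht
    have hε : 0 < ε := hε
    have h0 : F 0 (u ε 0) + kin ε 0 ≤ K₁ + 1 := by linarith [hK₁ _ (hinit ε hε)]
    refine ⟨?_, h0.trans (le_max_left _ _)⟩
    refine le_trans ?_ (le_max_right _ _)
    have hsub : Icc 0 t ⊆ Icc 0 T := Icc_subset_Icc_right ht.2
    have h1 := gronwall_fwd (f := fun r => F r (u ε r) + kin ε r + C₂ / C₁) (C := C₁) ht.1
      (fun r hr => ((hE ε hε r (hsub hr)).mono hsub).add_const _) (fun r hr => by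
        have h1 := (le_abs_self _).trans (hF2 r (hsub hr) (u ε r))
        have h2 := hDnn ε hε r (hsub hr)
        have h3 := mul_nonneg hC₁.le (hkin0 ε r)
        have e : C₁ * (F r (u ε r) + kin ε r + C₂ / C₁) = C₁ * F r (u ε r) + C₁ * kin ε r + C₂ := by
          field_simp
        rw [e]
        linarith)
    simp only [sub_zero] at h1
    have h2 : Real.exp (C₁ * t) * (F 0 (u ε 0) + kin ε 0 + C₂ / C₁)
        ≤ Real.exp (C₁ * T) * (K₁ + 1 + C₂ / C₁) := by
      have := hFlow 0 h0T (u ε 0)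
      have := hkin0 ε 0
      have := ht.2
      refine mul_le_mul (Real.exp_le_exp.2 (by gcongr)) (by linarith) (by linarith) (Real.exp_pos _).le
    have := hkin0 ε t
    linarith
  obtain ⟨Cd, hCd⟩ : ∃ Cd, Cd = C₁ * K + C₂ := ⟨_, rfl⟩
  have hdb : ∀ᶠ ε in 𝓝[>] (0 : ℝ), ∀ t ∈ Icc 0 T, ‖dtF t (u ε t)‖ ≤ Cd := by
    filter_upwards [hK] with ε h t ht
    rw [Real.norm_eq_abs, hCd]
    refine (hF2 t ht _).trans ?_
    have := mul_le_mul_of_nonneg_left (h t ht).1 hC₁.le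
    linarith
  have hDT : ∀ᶠ ε in 𝓝[>] (0 : ℝ), D ε T - D ε 0 ≤ Cd * T + K + C₂ / C₁ := by
    filter_upwards [hK, hdb, self_mem_nhdsWithin] with ε h1 h2 hε
    rw [hDdiff ε hε 0 T le_rfl hT.le le_rfl]
    have h3 : ‖∫ r in (0 : ℝ)..T, dtF r (u ε r)‖ ≤ Cd * |T - 0| := by
      apply intervalIntegral.norm_integral_le_of_norm_le_const
      intro r hr
      rw [uIoc_of_le hT.le] at hr
      exact h2 r (Ioc_subset_Icc_self hr)
    rw [sub_zero, abs_of_pos hT] at h3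
    have h4 := (le_abs_self _).trans h3
    have h5 := (h1 0 h0T).2
    have h6 := hFlow T ⟨hT.le, le_rfl⟩ (u ε T)
    have h7 := hkin0 ε T
    linarith
  have hkc : ∀ ε > (0 : ℝ), ContinuousOn (kin ε) (Icc 0 T) := by
    intro ε hε
    rw [hkin]
    have h1 := hu'c ε hε
    have h2 : ContinuousOn (fun t => A (u' ε t)) (Icc 0 T) := A.continuous.comp_continuousOn h1
    exact continuousOn_const.mul (h2.inner h1)
  have hBc : ∀ ε > (0 : ℝ), ContinuousOn (fun t => ε * ⟪B (u' ε t), u' ε t⟫) (Icc 0 T) := by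
    intro ε hε
    have h1 := hu'c ε hε
    have h2 : ContinuousOn (fun t => B (u' ε t)) (Icc 0 T) := B.continuous.comp_continuousOn h1
    exact continuousOn_const.mul (h2.inner h1)
  have hkint : ∀ᶠ ε in 𝓝[>] (0 : ℝ), ∫ t in (0 : ℝ)..T, kin ε t
      ≤ (‖A‖ / (2 * β) * (Cd * T + K + C₂ / C₁)) * ε := by
    filter_upwards [hDT, self_mem_nhdsWithin] with ε h1 hε
    have hε : 0 < ε := hε
    have hI : ∫ t in (0 : ℝ)..T, ε * ⟪B (u' ε t), u' ε t⟫ = D ε T - D ε 0 := by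
      refine intervalIntegral.integral_eq_sub_of_hasDerivAt_of_le hT.le
        (fun t ht => (hD ε hε t ht).continuousWithinAt)
        (fun t ht => (hD ε hε t (Ioo_subset_Icc_self ht)).hasDerivAt (Icc_mem_nhds ht.1 ht.2)) ?_
      refine ContinuousOn.intervalIntegrable ?_
      rw [uIcc_of_le hT.le]
      exact hBc ε hε
    have hle : ∫ t in (0 : ℝ)..T, kin ε t
        ≤ ∫ t in (0 : ℝ)..T, (‖A‖ / (2 * β) * ε) * (ε * ⟪B (u' ε t), u' ε t⟫) := by
      refine intervalIntegral.integral_mono_on hT.le ?_ ?_ ?_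
      · refine ContinuousOn.intervalIntegrable ?_
        rw [uIcc_of_le hT.le]
        exact hkc ε hε
      · refine ContinuousOn.intervalIntegrable ?_
        rw [uIcc_of_le hT.le]
        exact continuousOn_const.mul (hBc ε hε)
      · intro t ht
        have h2 : ⟪A (u' ε t), u' ε t⟫ ≤ ‖A‖ * ‖u' ε t‖ * ‖u' ε t‖ :=
          (real_inner_le_norm _ _).trans (by gcongr; exact A.le_opNorm _)
        calc kin ε t ≤ ε ^ 2 / 2 * (‖A‖ * ‖u' ε t‖ * ‖u' ε t‖) := by
              rw [hkin]
              exact mul_le_mul_of_nonneg_left h2 (by positivity)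
          _ = (‖A‖ / (2 * β) * ε) * (ε * β * ‖u' ε t‖ ^ 2) := by field_simp
          _ ≤ _ := by
              have := hDv ε hε t ht
              gcongr
    rw [intervalIntegral.integral_const_mul, hI] at hle
    refine hle.trans ?_
    calc ‖A‖ / (2 * β) * ε * (D ε T - D ε 0) ≤ ‖A‖ / (2 * β) * ε * (Cd * T + K + C₂ / C₁) := by gcongr
      _ = _ := by ring
  obtain ⟨good, hgood⟩ : ∃ good : ℝ → Prop, good = fun a =>
    ∀ η > (0 : ℝ), ∃ᶠ ε in 𝓝[>] (0 : ℝ), kin ε a < η := ⟨_, rfl⟩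
  have hdense : ∀ a b, 0 ≤ a → a < b → b ≤ T → ∃ t ∈ Ioo a b, good t := by
    rw [hgood]
    exact fatou_good hT hkc (fun ε _ t _ => hkin0 ε t) hkint
  have hgood0 : good 0 := by
    rw [hgood]
    intro η hη
    exact (hkinlim.eventually (gt_mem_nhds hη)).frequently
  -- passage to the limit
  have hFc : ContinuousOn (fun p : ℝ × X => F p.1 p.2) (Icc 0 T ×ˢ univ) := hF0.continuousOn
  have hjoint : ∀ {Y : Type} [TopologicalSpace Y] (g : ℝ × X → Y),
      ContinuousOn g (Icc 0 T ×ˢ univ) → ∀ (l : Filter ℝ) (s : ℝ) (v : ℝ → X) (x : X), s ∈ Icc 0 T →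
      Tendsto id l (𝓝[Icc 0 T] s) → Tendsto v l (𝓝 x) →
      Tendsto (fun r => g (r, v r)) l (𝓝 (g (s, x))) := by
    intro Y _ g hg l s v x hs hl hv
    have h1 : Tendsto g (𝓝[Icc 0 T ×ˢ univ] (s, x)) (𝓝 (g (s, x))) := hg (s, x) ⟨hs, mem_univ _⟩
    refine h1.comp ?_
    rw [nhdsWithin_prod_eq, nhdsWithin_univ]
    exact hl.prodMk hv
  have hlconv : ∀ t ∈ Icc 0 T, ∀ g : ℝ × X → ℝ, ContinuousOn g (Icc 0 T ×ˢ univ) →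
      Tendsto (fun ε => g (t, u ε t)) (𝓝[>] 0) (𝓝 (g (t, u₀ t))) := by
    intro t ht g hg
    have h1 : Continuous (fun x => g (t, x)) := by
      rw [← continuousOn_univ]
      exact hg.comp (by fun_prop) (fun x _ => ⟨ht, mem_univ _⟩)
    exact (h1.tendsto _).comp (hconv t ht)
  obtain ⟨g, hg⟩ : ∃ g : ℝ → ℝ, g = fun r => dtF r (u₀ r) := ⟨_, rfl⟩
  have hgconv : ∀ t ∈ Icc 0 T, Tendsto (fun ε => dtF t (u ε t)) (𝓝[>] 0) (𝓝 (g t)) := by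
    intro t ht
    rw [hg]
    exact hlconv t ht (fun p => dtF p.1 p.2) hdc
  have hgb : ∀ t ∈ Icc 0 T, ‖g t‖ ≤ Cd := by
    intro t ht
    refine le_of_tendsto (hgconv t ht).norm ?_
    filter_upwards [hdb] with ε h
    exact h t ht
  have hgint : IntegrableOn g (Icc 0 T) volume := by
    have hm : AEStronglyMeasurable g (volume.restrict (Icc 0 T)) := by
      have hι : Tendsto (fun n : ℕ => 1 / ((n : ℝ) + 1)) atTop (𝓝[>] 0) :=
        tendsto_nhdsWithin_iff.2 ⟨tendsto_one_div_add_atTop_nhds_zero_nat,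
          Eventually.of_forall fun n => by simp only [mem_Ioi]; positivity⟩
      refine aestronglyMeasurable_of_tendsto_ae atTop
        (f := fun (n : ℕ) t => dtF t (u (1 / ((n : ℝ) + 1)) t)) (fun n => ?_) ?_
      · exact (hdtc _ (by positivity)).aestronglyMeasurable measurableSet_Icc
      · filter_upwards [ae_restrict_mem measurableSet_Icc] with t ht
        exact (hgconv t ht).comp hι
    refine Integrable.of_bound hm Cd ?_
    filter_upwards [ae_restrict_mem measurableSet_Icc] with t ht
    exact hgb t ht
  have hgii : ∀ a b, 0 ≤ a → a ≤ b → b ≤ T → IntervalIntegrable g volume a b := by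
    intro a b h1 h2 h3
    rw [intervalIntegrable_iff_integrableOn_Icc_of_le h2]
    exact hgint.mono_set (Icc_subset_Icc h1 h3)
  have hIconv : ∀ a b, 0 ≤ a → a ≤ b → b ≤ T →
      Tendsto (fun ε => ∫ r in a..b, dtF r (u ε r)) (𝓝[>] 0) (𝓝 (∫ r in a..b, g r)) := by
    intro a b h1 h2 h3
    have hsub : uIoc a b ⊆ Icc 0 T := by
      rw [uIoc_of_le h2]
      exact Ioc_subset_Icc_self.trans (Icc_subset_Icc h1 h3)
    refine intervalIntegral.tendsto_integral_filter_of_dominated_convergence (fun _ => Cd) ?_ ?_ ?_ ?_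
    · filter_upwards [self_mem_nhdsWithin] with ε hε
      exact ((hdtc ε hε).mono hsub).aestronglyMeasurable measurableSet_uIoc
    · filter_upwards [hdb] with ε h
      exact Eventually.of_forall fun r hr => h r (hsub hr)
    · exact intervalIntegrable_const
    · exact Eventually.of_forall fun r hr => hgconv r (hsub hr)
  obtain ⟨I, hI⟩ : ∃ I : ℝ → ℝ, I = fun t => ∫ r in (0 : ℝ)..t, g r := ⟨_, rfl⟩
  have hIdiff : ∀ a b, 0 ≤ a → a ≤ b → b ≤ T → ∫ r in a..b, g r = I b - I a := by
    intro a b h1 h2 h3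
    rw [hI]
    exact (intervalIntegral.integral_interval_sub_left (hgii 0 b le_rfl (by linarith) h3)
      (hgii 0 a le_rfl h1 (by linarith))).symm
  have hIc : ContinuousOn I (Icc 0 T) := by
    rw [hI]
    have := intervalIntegral.continuousOn_primitive_interval (μ := volume) (f := g) (a := 0) (b := T)
      (by rwa [uIcc_of_le hT.le])
    rwa [uIcc_of_le hT.le] at this
  obtain ⟨Φ, hΦ⟩ : ∃ Φ : ℝ → ℝ, Φ = fun t => F t (u₀ t) - I t := ⟨_, rfl⟩
  have hkey : ∀ a b c, good a → 0 ≤ a → a ≤ b → b ≤ T →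
      (∀ᶠ ε in 𝓝[>] (0 : ℝ), c ≤ D ε b - D ε a) → Φ b + c ≤ Φ a := by
    intro a b c hga h1 h2 h3 hc
    rw [hgood] at hga
    have hlim : Tendsto (fun ε => (∫ r in a..b, dtF r (u ε r)) + F a (u ε a) - F b (u ε b)) (𝓝[>] 0)
        (𝓝 ((∫ r in a..b, g r) + F a (u₀ a) - F b (u₀ b))) :=
      ((hIconv a b h1 h2 h3).add (hlconv a ⟨h1, by linarith⟩ (fun p => F p.1 p.2) hFc)).sub
        (hlconv b ⟨by linarith, h3⟩ (fun p => F p.1 p.2) hFc)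
    rw [hIdiff a b h1 h2 h3] at hlim
    suffices h : c ≤ I b - I a + F a (u₀ a) - F b (u₀ b) by
      simp only [hΦ]; linarith
    refine le_of_forall_pos_le_add fun η hη => ?_
    have hev : ∀ᶠ ε in 𝓝[>] (0 : ℝ), (∫ r in a..b, dtF r (u ε r)) + F a (u ε a) - F b (u ε b)
        < I b - I a + F a (u₀ a) - F b (u₀ b) + η / 2 :=
      hlim.eventually_lt_const (by linarith)
    obtain ⟨ε, h4, h5, h6, h7⟩ := ((hga (η / 2) (by linarith)).and_eventually
      (hev.and (hc.and self_mem_nhdsWithin))).exists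
    rw [hDdiff ε h7 a b h1 h2 h3] at h6
    have h8 := hkin0 ε b
    linarith
  have hkey0 : ∀ a b, good a → 0 ≤ a → a ≤ b → b ≤ T → Φ b ≤ Φ a := by
    intro a b hga h1 h2 h3
    have := hkey a b 0 hga h1 h2 h3 (by
      filter_upwards [self_mem_nhdsWithin] with ε hε
      linarith [hDmono ε hε a b h1 h2 h3])
    linarith
  -- one-sided limits
  have hidR : ∀ s ∈ Ico 0 T, Tendsto id (𝓝[>] s) (𝓝[Icc 0 T] s) := by
    intro s hs
    refine tendsto_nhdsWithin_iff.2 ⟨tendsto_id.mono_left nhdsWithin_le_nhds, ?_⟩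
    filter_upwards [Ioo_mem_nhdsGT hs.2] with r hr
    exact ⟨hs.1.trans hr.1.le, hr.2.le⟩
  have hidL : ∀ s ∈ Ioc 0 T, Tendsto id (𝓝[<] s) (𝓝[Icc 0 T] s) := by
    intro s hs
    refine tendsto_nhdsWithin_iff.2 ⟨tendsto_id.mono_left nhdsWithin_le_nhds, ?_⟩
    filter_upwards [Ioo_mem_nhdsLT hs.1] with r hr
    exact ⟨hr.1.le, hr.2.le.trans hs.2⟩
  obtain ⟨Pp, hPp⟩ : ∃ Pp : ℝ → ℝ, Pp = fun t => F t (up t) - I t := ⟨_, rfl⟩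
  obtain ⟨Pm, hPm⟩ : ∃ Pm : ℝ → ℝ, Pm = fun t => F t (um t) - I t := ⟨_, rfl⟩
  have hΦR : ∀ s ∈ Ico 0 T, Tendsto Φ (𝓝[>] s) (𝓝 (Pp s)) := by
    intro s hs
    have hs' : s ∈ Icc 0 T := Ico_subset_Icc_self hs
    rw [hΦ, hPp]
    exact (hjoint (fun p => F p.1 p.2) hFc _ s u₀ (up s) hs' (hidR s hs) (hup s hs)).sub
      ((hIc s hs').tendsto.comp (hidR s hs))
  have hΦL : ∀ s ∈ Ioc 0 T, Tendsto Φ (𝓝[<] s) (𝓝 (Pm s)) := by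
    intro s hs
    have hs' : s ∈ Icc 0 T := Ioc_subset_Icc_self hs
    rw [hΦ, hPm]
    exact (hjoint (fun p => F p.1 p.2) hFc _ s u₀ (um s) hs' (hidL s hs) (hum s hs)).sub
      ((hIc s hs').tendsto.comp (hidL s hs))
  have hupR : ∀ s ∈ Ico 0 T, Tendsto up (𝓝[>] s) (𝓝 (up s)) := by
    intro s hs
    rw [Metric.tendsto_nhds]
    intro η hη
    have h1 := (Metric.tendsto_nhds.1 (hup s hs)) (η / 2) (by linarith)
    obtain ⟨l, hl, hl2⟩ := (mem_nhdsGT_iff_exists_Ioo_subset' hs.2).1 h1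
    filter_upwards [Ioo_mem_nhdsGT (lt_min hl hs.2)] with r hr
    have hr2 := lt_min_iff.1 hr.2
    have h2 : up r ∈ Metric.closedBall (up s) (η / 2) := by
      refine Metric.isClosed_closedBall.mem_of_tendsto (hup r ⟨hs.1.trans hr.1.le, hr2.2⟩) ?_
      filter_upwards [Ioo_mem_nhdsGT hr2.1] with x hx
      exact Metric.ball_subset_closedBall (hl2 ⟨hr.1.trans hx.1, hx.2⟩)
    exact (Metric.mem_closedBall.1 h2).trans_lt (by linarith)
  have hupL : ∀ s ∈ Ioc 0 T, Tendsto up (𝓝[<] s) (𝓝 (um s)) := by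
    intro s hs
    rw [Metric.tendsto_nhds]
    intro η hη
    have h1 := (Metric.tendsto_nhds.1 (hum s hs)) (η / 2) (by linarith)
    obtain ⟨l, hl, hl2⟩ := (mem_nhdsLT_iff_exists_Ioo_subset' hs.1).1 h1
    filter_upwards [Ioo_mem_nhdsLT (max_lt hl hs.1)] with r hr
    have hr2 := max_lt_iff.1 hr.1
    have h2 : up r ∈ Metric.closedBall (um s) (η / 2) := by
      refine Metric.isClosed_closedBall.mem_of_tendsto (hup r ⟨hr2.2.le, hr.2.trans_le hs.2⟩) ?_
      filter_upwards [Ioo_mem_nhdsGT hr.2] with x hx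
      exact Metric.ball_subset_closedBall (hl2 ⟨hr2.1.trans hx.1, hx.2⟩)
    exact (Metric.mem_closedBall.1 h2).trans_lt (by linarith)
  have hcritp : ∀ t ∈ Icc 0 T, gradF t (up t) = 0 := by
    intro t ht
    rcases ht.1.eq_or_lt with h | h
    · subst h
      have h1 : Tendsto (fun r => gradF r (up r)) (𝓝[>] 0) (𝓝 (gradF 0 (up 0))) := by
        have h1 : Tendsto (fun p : ℝ × X => gradF p.1 p.2) (𝓝[Icc 0 T ×ˢ univ] (0, up 0))
          (𝓝 (gradF 0 (up 0))) := hgc (0, up 0) ⟨ht, mem_univ _⟩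
        refine h1.comp (f := fun r => (r, up r)) ?_
        rw [nhdsWithin_prod_eq, nhdsWithin_univ]
        exact (hidR 0 ⟨le_rfl, hT⟩).prodMk (hupR 0 ⟨le_rfl, hT⟩)
      refine tendsto_nhds_unique h1 (tendsto_const_nhds.congr' ?_)
      filter_upwards [Ioo_mem_nhdsGT hT] with r hr
      exact ((hstab r ⟨hr.1, hr.2.le⟩).1).symm
    · exact (hstab t ⟨h, ht.2⟩).1
  have hminus : ∀ s ∈ Icc 0 T, ∀ δ > (0 : ℝ), ∃ a, good a ∧ 0 ≤ a ∧ s - δ < a ∧ a ≤ s ∧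
      |Φ a - Pm s| < δ ∧ ‖u₀ a - um s‖ < δ := by
    intro s hs δ hδ
    rcases hs.1.eq_or_lt with h | h
    · subst h
      refine ⟨0, hgood0, le_rfl, by linarith, le_rfl, ?_, ?_⟩
      · simp [hΦ, hPm, hum0, hδ]
      · simp [hum0, hδ]
    · have hs' : s ∈ Ioc 0 T := ⟨h, hs.2⟩
      have h1 := (Metric.tendsto_nhds.1 (hum s hs')) δ hδ
      have h2 := (Metric.tendsto_nhds.1 (hΦL s hs')) δ hδ
      have h3 : ∀ᶠ r in 𝓝[<] s, s - δ < r ∧ 0 < r := by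
        filter_upwards [Ioo_mem_nhdsLT (show s - δ < s by linarith), Ioo_mem_nhdsLT h] with r h1 h2
        exact ⟨h1.1, h2.1⟩
      obtain ⟨l, hl, hl2⟩ := (mem_nhdsLT_iff_exists_Ioo_subset' h).1 (h1.and (h2.and h3))
      obtain ⟨a, ha, hga⟩ := hdense (max l 0) s (le_max_right _ _) (max_lt hl h) hs.2
      obtain ⟨e1, e2, e3, e4⟩ := hl2 ⟨(le_max_left _ _).trans_lt ha.1, ha.2⟩
      refine ⟨a, hga, e4.le, e3, ha.2.le, ?_, ?_⟩
      · rwa [Real.dist_eq] at e2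
      · rwa [dist_eq_norm] at e1
  have hplus : ∀ s ∈ Icc 0 T, ∀ δ > (0 : ℝ), ∃ b, s ≤ b ∧ b ≤ T ∧ b < s + δ ∧
      |Φ b - Pp s| < δ ∧ ‖u₀ b - up s‖ < δ := by
    intro s hs δ hδ
    rcases hs.2.eq_or_lt with h | h
    · subst h
      refine ⟨s, le_rfl, le_rfl, by linarith, ?_, ?_⟩
      · simp [hΦ, hPp, hupT, hδ]
      · simp [hupT, hδ]
    · have hs' : s ∈ Ico 0 T := ⟨hs.1, h⟩
      have h1 := (Metric.tendsto_nhds.1 (hup s hs')) δ hδ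
      have h2 := (Metric.tendsto_nhds.1 (hΦR s hs')) δ hδ
      have h3 : ∀ᶠ r in 𝓝[>] s, r ∈ Ioo s T := Ioo_mem_nhdsGT h
      have h4 : ∀ᶠ r in 𝓝[>] s, r ∈ Ioo s (s + δ) := Ioo_mem_nhdsGT (by linarith)
      obtain ⟨b, e1, e2, e3, e4⟩ := (h1.and (h2.and (h3.and h4))).exists
      refine ⟨b, e3.1.le, e3.2.le, e4.2, ?_, ?_⟩
      · rwa [Real.dist_eq] at e2
      · rwa [dist_eq_norm] at e1
  have hplusgood : ∀ s ∈ Ico 0 T, ∀ δ > (0 : ℝ), ∃ a, good a ∧ s < a ∧ a < T ∧ a < s + δ ∧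
      |Φ a - Pp s| < δ := by
    intro s hs δ hδ
    have h2 := (Metric.tendsto_nhds.1 (hΦR s hs)) δ hδ
    obtain ⟨l, hl, hl2⟩ := (mem_nhdsGT_iff_exists_Ioo_subset' hs.2).1 h2
    obtain ⟨a, ha, hga⟩ := hdense s (min (min l T) (s + δ)) hs.1
      (lt_min (lt_min hl hs.2) (by linarith)) ((min_le_left _ _).trans (min_le_right _ _))
    obtain ⟨e1, e2⟩ := lt_min_iff.1 ha.2
    obtain ⟨e3, e4⟩ := lt_min_iff.1 e1
    refine ⟨a, hga, ha.1, e4, e2, ?_⟩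
    have this : dist (Φ a) (Pp s) < δ := hl2 ⟨ha.1, e3⟩
    rwa [Real.dist_eq] at this
  -- monotonicity of the one-sided limits of the energy
  have hMP : ∀ s ∈ Icc 0 T, Pp s ≤ Pm s := by
    intro s hs
    refine le_of_forall_pos_le_add fun δ hδ => ?_
    obtain ⟨a, ha1, ha2, ha3, ha4, ha5, ha6⟩ := hminus s hs (δ / 2) (by linarith)
    obtain ⟨b, hb1, hb2, hb3, hb4, hb5⟩ := hplus s hs (δ / 2) (by linarith)
    have h1 := hkey0 a b ha1 ha2 (ha4.trans hb1) hb2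
    have h2 := abs_lt.1 ha5
    have h3 := abs_lt.1 hb4
    linarith [h2.2, h3.1]
  have hPM : ∀ s t, 0 ≤ s → s < t → t ≤ T → Pm t ≤ Pp s := by
    intro s t hs hst htT
    refine le_of_forall_pos_le_add fun δ hδ => ?_
    obtain ⟨δ', hδ', e1, e2⟩ : ∃ δ' > (0 : ℝ), δ' ≤ δ / 2 ∧ δ' ≤ (t - s) / 2 :=
      ⟨min (δ / 2) ((t - s) / 2), lt_min (by linarith) (by linarith), min_le_left _ _, min_le_right _ _⟩
    obtain ⟨a, ha1, ha2, ha3, ha4, ha5⟩ := hplusgood s ⟨hs, by linarith⟩ δ' hδ'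
    obtain ⟨b, hb1, hb2, hb3, hb4, hb5, hb6⟩ := hminus t ⟨by linarith, htT⟩ δ' hδ'
    have h1 := hkey0 a b ha1 (by linarith) (by linarith) (by linarith)
    have h2 := abs_lt.1 ha5
    have h3 := abs_lt.1 hb5
    linarith [h2.2, h3.1]
  have hleft : ∀ t ∈ Ioc 0 T, Tendsto (fun r => - Pp r) (𝓝[<] t) (𝓝 (- Pm t)) := by
    intro t ht
    have ht' : t ∈ Icc 0 T := Ioc_subset_Icc_self ht
    rw [hPp, hPm]
    exact ((hjoint (fun p => F p.1 p.2) hFc _ t up (um t) ht' (hidL t ht) (hupL t ht)).sub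
      ((hIc t ht').tendsto.comp (hidL t ht))).neg
  -- jumps dissipate energy
  have hstrict : ∀ t ∈ Icc 0 T, (up t ≠ um t ∨ (u₀ t ≠ up t ∧ u₀ t ≠ um t)) → Pp t < Pm t := by
    intro t ht hjump
    obtain ⟨q, hqp, hq⟩ : ∃ q, q ≠ up t ∧ (q = um t ∨ (up t = um t ∧ q = u₀ t)) := by
      by_cases h : up t = um t
      · rcases hjump with h1 | h1
        · exact absurd h h1
        · exact ⟨u₀ t, h1.1, Or.inr ⟨h, rfl⟩⟩
      · exact ⟨um t, fun h' => h h'.symm, Or.inl rfl⟩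
    obtain ⟨r, hr, hriso⟩ := hF5 t ht (up t) (hcritp t ht)
    have hd : 0 < ‖q - up t‖ := norm_pos_iff.2 (sub_ne_zero.2 hqp)
    obtain ⟨ρ, hρ, hρr, hρd⟩ : ∃ ρ > (0 : ℝ), ρ < r ∧ 2 * ρ ≤ ‖q - up t‖ := by
      refine ⟨min r ‖q - up t‖ / 2, by positivity, ?_, ?_⟩
      · linarith [min_le_left r ‖q - up t‖]
      · linarith [min_le_right r ‖q - up t‖]
    have hcrit : ∀ x, ‖x - up t‖ = ρ → gradF t x ≠ 0 := by
      intro x hx h0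
      have := hriso x h0 (by rw [Metric.mem_ball, dist_eq_norm, hx]; exact hρr)
      rw [this, sub_self, norm_zero] at hx
      exact hρ.ne hx
    obtain ⟨c, hc, δ, hδ, hcross⟩ := cross_cost A B hgc ht hρ hβ hcrit
    obtain ⟨δ', hδ', e1, e2, e3⟩ : ∃ δ' > (0 : ℝ), δ' ≤ δ ∧ δ' ≤ ρ / 4 ∧ δ' ≤ c / 4 :=
      ⟨min δ (min (ρ / 4) (c / 4)), by positivity, min_le_left _ _,
        (min_le_right _ _).trans (min_le_left _ _), (min_le_right _ _).trans (min_le_right _ _)⟩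
    obtain ⟨a, ha1, ha2, ha3, ha4, ha5, ha6⟩ := hminus t ht δ' hδ'
    obtain ⟨b, hb1, hb2, hb3, hb4, hb5⟩ := hplus t ht δ' hδ'
    have hnc : ∀ x ∈ Icc 0 T, Tendsto (fun ε => ‖u ε x - up t‖) (𝓝[>] 0) (𝓝 ‖u₀ x - up t‖) :=
      fun x hx => ((hconv x hx).sub_const _).norm
    have haI : a ∈ Icc 0 T := ⟨ha2, ha4.trans ht.2⟩
    have hbI : b ∈ Icc 0 T := ⟨ht.1.trans hb1, hb2⟩
    have hcost : ∀ᶠ ε in 𝓝[>] (0 : ℝ), c ≤ D ε b - D ε a := by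
      rcases hq with hq | ⟨hq1, hq2⟩
      · have h1 : 3 * ρ / 2 < ‖u₀ a - up t‖ := by
          have h2 : ‖q - up t‖ ≤ ‖u₀ a - up t‖ + ‖u₀ a - um t‖ := by
            rw [hq]
            calc ‖um t - up t‖ = ‖(u₀ a - up t) - (u₀ a - um t)‖ := by congr 1; abel
              _ ≤ _ := norm_sub_le _ _
          linarith
        have h2 : ‖u₀ b - up t‖ < ρ / 2 := by linarith
        filter_upwards [self_mem_nhdsWithin, (hnc a haI).eventually_const_lt h1,
          (hnc b hbI).eventually_lt_const h2] with ε hε h3 h4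
        refine hcross ε hε a b ha2 (ha4.trans hb1) hb2 (by linarith) (by linarith) (u ε) (u' ε) (u'' ε)
          (D ε) _ (hu' ε hε) (hu'' ε hε) (hode ε hε) (hD ε hε) (hDv ε hε) ?_ ?_
        · rw [mem_uIcc]; right; constructor <;> linarith
        · rw [abs_of_nonneg (by linarith)]; linarith
      · have h1 : ‖u₀ a - up t‖ < ρ / 2 := by rw [hq1]; linarith
        have h2 : 3 * ρ / 2 < ‖u₀ t - up t‖ := by rw [← hq2]; linarith
        filter_upwards [self_mem_nhdsWithin, (hnc a haI).eventually_lt_const h1,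
          (hnc t ht).eventually_const_lt h2] with ε hε h3 h4
        have h5 := hDmono ε hε t b ht.1 hb1 hb2
        have h6 : c ≤ D ε t - D ε a := by
          refine hcross ε hε a t ha2 ha4 ht.2 (by linarith) (by linarith) (u ε) (u' ε) (u'' ε)
            (D ε) _ (hu' ε hε) (hu'' ε hε) (hode ε hε) (hD ε hε) (hDv ε hε) ?_ ?_
          · rw [mem_uIcc]; left; constructor <;> linarith
          · rw [abs_of_nonpos (by linarith)]; linarith
        linarith
    have h1 := hkey a b c ha1 ha2 (ha4.trans hb1) hb2 hcost
    have h2 := abs_lt.1 ha5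
    have h3 := abs_lt.1 hb4
    linarith [h2.2, h3.1]
  -- the continuous part does not dissipate
  have hdini : ∀ s ∈ Ico 0 T, ∀ δ > (0 : ℝ), ∀ᶠ t in 𝓝[>] s, - Pp t - - Pp s ≤ δ * (t - s) := by
    intro s hs δ hδ
    have hs' : s ∈ Icc 0 T := Ico_subset_Icc_self hs
    obtain ⟨x, hx⟩ : ∃ x, x = up s := ⟨_, rfl⟩
    have hcx : gradF s x = 0 := by rw [hx]; exact hcritp s hs'
    obtain ⟨r, hr, L, hL, hLip⟩ := hF3' x
    obtain ⟨r', hr', hiso⟩ := hF5 s hs' x hcx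
    have hδ1 : 0 < δ / (2 * (L + 1)) := by positivity
    have hδL : δ / (2 * (L + 1)) * L ≤ δ / 2 := by
      rw [div_mul_eq_mul_div, div_le_div_iff₀ (by positivity) (by norm_num)]
      nlinarith
    have hF : ∀ᶠ v in 𝓝 x, F s x - F s v ≤ δ / (2 * (L + 1)) * ‖gradF s v‖ := by
      have h1 : ((-(δ / (2 * (L + 1))) : ℝ) : EReal)
          < Filter.liminf (fun v : X => (((F s v - F s x) / ‖gradF s v‖ : ℝ) : EReal)) (𝓝[≠] x) := by
        refine lt_of_lt_of_le ?_ (hF6 s hs' x hcx)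
        exact_mod_cast neg_lt_zero.2 hδ1
      have h2 := eventually_nhdsWithin_iff.1 (eventually_lt_of_lt_liminf h1)
      filter_upwards [h2, Metric.ball_mem_nhds x hr'] with v hv hvb
      by_cases hvx : v = x
      · rw [hvx]; simp [hcx]
      · have h3 := EReal.coe_lt_coe_iff.1 (hv hvx)
        have h4 : 0 < ‖gradF s v‖ := norm_pos_iff.2 fun h0 => hvx (hiso v h0 hvb)
        rw [lt_div_iff₀ h4] at h3
        linarith
    have hdt : ContinuousWithinAt (fun p : ℝ × X => dtF p.1 p.2) (Icc 0 T ×ˢ univ) (s, x) :=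
      hdc (s, x) ⟨hs', mem_univ _⟩
    obtain ⟨η, hη, hηd⟩ := Metric.continuousWithinAt_iff.1 hdt (δ / 4) (by linarith)
    have hηd' : ∀ r ∈ Icc 0 T, |r - s| < η → ∀ z, dist z x < η → |dtF r z - dtF s x| < δ / 4 := by
      intro r hr h1 z h2
      have := @hηd (r, z) ⟨hr, mem_univ _⟩ (by
        rw [Prod.dist_eq, Real.dist_eq]; exact max_lt h1 h2)
      rwa [Real.dist_eq] at this
    have hup' := hup s hs
    have hupR' := hupR s hs
    rw [← hx] at hup' hupR'
    have h1 := (Metric.tendsto_nhds.1 hup') η hη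
    obtain ⟨l, hl, hl2⟩ := (mem_nhdsGT_iff_exists_Ioo_subset' hs.2).1 h1
    filter_upwards [Ioo_mem_nhdsGT hl, Ioo_mem_nhdsGT hs.2,
      Ioo_mem_nhdsGT (show s < s + η by linarith), hupR'.eventually hF,
      hupR'.eventually (Metric.ball_mem_nhds x hη), hupR'.eventually (Metric.ball_mem_nhds x hr)]
      with t ht1 ht2 ht3 ht4 ht5 ht6
    have ht : t ∈ Icc 0 T := ⟨hs.1.trans ht1.1.le, ht2.2.le⟩
    have hst : s < t := ht1.1
    have hsub : Icc s t ⊆ Icc 0 T := Icc_subset_Icc hs.1 ht.2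
    -- the gradient at time s
    have hA1 : ‖gradF s (up t)‖ ≤ L * (t - s) := by
      have := hLip (up t) ht6 s hs' t ht
      rwa [hcritp t ht, sub_zero, abs_sub_comm, abs_of_pos (sub_pos.2 hst)] at this
    have hA2 : F s x - F s (up t) ≤ δ / 2 * (t - s) := by
      calc F s x - F s (up t) ≤ δ / (2 * (L + 1)) * ‖gradF s (up t)‖ := ht4
        _ ≤ δ / (2 * (L + 1)) * (L * (t - s)) := mul_le_mul_of_nonneg_left hA1 hδ1.le
        _ = δ / (2 * (L + 1)) * L * (t - s) := by ring
        _ ≤ δ / 2 * (t - s) := mul_le_mul_of_nonneg_right hδL (by linarith)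
    -- time dependence
    have hA3 : (dtF s x - δ / 4) * (t - s) ≤ F t (up t) - F s (up t) := by
      have := le_of_hasDerivWithinAt_nonpos
        (f := fun r => (dtF s x - δ / 4) * r - F r (up t))
        (f' := fun r => (dtF s x - δ / 4) * 1 - dtF r (up t)) hst.le
        (fun r hr => ((hasDerivWithinAt_id r _).const_mul _).sub
          ((hdtF (up t) r (hsub hr)).mono hsub))
        (fun r hr => by
          have h2 := hηd' r (hsub hr) (by
            rw [abs_of_nonneg (by linarith [hr.1])]; linarith [hr.2, ht3.2]) (up t) ht5
          have h3 := abs_lt.1 h2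
          linarith [h3.1])
      linarith
    have hA4 : I t - I s ≤ (dtF s x + δ / 4) * (t - s) := by
      rw [← hIdiff s t hs.1 hst.le ht.2]
      have h2 : ∫ r in s..t, g r ≤ ∫ _ in s..t, (dtF s x + δ / 4) := by
        refine intervalIntegral.integral_mono_on_of_le_Ioo hst.le (hgii s t hs.1 hst.le ht.2)
          intervalIntegrable_const fun r hr => ?_
        have h3 : dist (u₀ r) x < η := hl2 ⟨hr.1, hr.2.trans ht1.2⟩
        have h4 := hηd' r (hsub (Ioo_subset_Icc_self hr)) (by
            rw [abs_of_nonneg (by linarith [hr.1])]; linarith [hr.2, ht3.2]) (u₀ r) h3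
        rw [hg]
        have h5 := abs_lt.1 h4
        simp only
        linarith [h5.2]
      rw [intervalIntegral.integral_const, smul_eq_mul] at h2
      linarith
    simp only [hPp, ← hx]
    linarith
  have hJ' : ∀ t, t ∈ J ↔ t ∈ Icc 0 T ∧ - Pm t < - Pp t := by
    intro t
    rw [hJ]
    constructor
    · rintro ⟨h1, h2⟩
      exact ⟨h1, neg_lt_neg (hstrict t h1 h2)⟩
    · rintro ⟨h1, h2⟩
      refine ⟨h1, Or.inl fun h => ?_⟩
      simp only [hPp, hPm, h, lt_irrefl] at h2
  obtain ⟨μ, hμ1, hμ2, hμ3⟩ := jump_measure (T := T) (P := fun t => - Pp t) (M := fun t => - Pm t)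
    (J := J) (fun s hs => neg_le_neg (hMP s hs)) (fun s t h1 h2 h3 => neg_le_neg (hPM s t h1 h2 h3))
    hleft hdini hJ'
  refine ⟨μ, hμ1, hμ2, fun s t h1 h2 h3 => ?_⟩
  have h4 := hIdiff s t h1 h2 h3
  simp only [hg] at h4
  rw [hμ3 s t h1 h2 h3, h4]
  simp only [hPp, hPm]
  ring
end
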